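/- arXiv:1201.3229 — 4 statements merged into one kernel-verified Lean document; each statement's English description precedes it below -/
import Mathlib

section
/- Let G = Sp₆(GF(2)) be the symplectic group of degree 6 over the field with two elements, and let V be an irreducible (simple) representation of G over GF(2) of dimension 8. Then the first group cohomology H¹(G, V) vanishes. -/
set_option maxRecDepth 10000

namespace Sp6

open Matrix

/-- The group `Sp₆(2)`. -/
abbrev G := Matrix.symplecticGroup (Fin 3) (ZMod 2)

/-- The natural module. -/
abbrev W := Fin 3 ⊕ Fin 3 → ZMod 2

/-- The symplectic form. -/
def B (x y : W) : ZMod 2 := ∑ i : Fin 3, (x (.inl i) * y (.inr i) + x (.inr i) * y (.inl i))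

/-- The dual vector of `a`. -/
def sw (a : W) : W := fun j => a j.swap

/-- The natural action. -/
def act (g : G) (x : W) : W := g.1 *ᵥ x

lemma act_mul (g h : G) (x : W) : act (g * h) x = act g (act h x) := by
  simp [act, Matrix.mulVec_mulVec]

lemma act_one (x : W) : act 1 x = x := by simp [act]

lemma act_add (g : G) (x y : W) : act g (x + y) = act g x + act g y := by
  simp [act, Matrix.mulVec_add]

lemma act_smul (g : G) (c : ZMod 2) (x : W) : act g (c • x) = c • act g x := by
  simp [act, Matrix.mulVec_smul]

lemma act_inv_act (g : G) (x : W) : act g⁻¹ (act g x) = x := by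
  rw [← act_mul, inv_mul_cancel, act_one]

lemma act_act_inv (g : G) (x : W) : act g (act g⁻¹ x) = x := by
  rw [← act_mul, mul_inv_cancel, act_one]

lemma act_ext {g h : G} (H : ∀ x, act g x = act h x) : g = h := by
  apply Subtype.ext
  apply Matrix.ext_of_mulVec_single
  intro i
  exact H _

lemma B_eq (x y : W) : B x y = x ⬝ᵥ (J (Fin 3) (ZMod 2) *ᵥ y) := by
  simp [B, J, dotProduct, Fintype.sum_sum_type, Matrix.fromBlocks_mulVec, Finset.sum_add_distrib,
    ZModModule.neg_eq_self, Function.comp_def]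

lemma B_mulVec (M : Matrix (Fin 3 ⊕ Fin 3) (Fin 3 ⊕ Fin 3) (ZMod 2)) (x y : W) :
    B (M *ᵥ x) (M *ᵥ y) = x ⬝ᵥ ((Mᵀ * J (Fin 3) (ZMod 2) * M) *ᵥ y) := by
  rw [B_eq, Matrix.mul_assoc, ← Matrix.mulVec_mulVec, ← Matrix.mulVec_mulVec,
    Matrix.dotProduct_mulVec x, Matrix.vecMul_transpose]

lemma B_act (g : G) (x y : W) : B (act g x) (act g y) = B x y := by
  rw [act, act, B_mulVec, SymplecticGroup.mem_iff'.1 g.2, ← B_eq]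

lemma B_comm (x y : W) : B x y = B y x := by
  unfold B; congr 1; ext i; ring

lemma B_add_left (x y z : W) : B (x + y) z = B x z + B y z := by
  simp [B, Fin.sum_univ_three]; ring

lemma B_add_right (x y z : W) : B z (x + y) = B z x + B z y := by
  simp [B, Fin.sum_univ_three]; ring

lemma B_smul_left (c : ZMod 2) (x z : W) : B (c • x) z = c * B x z := by
  simp [B, Fin.sum_univ_three]; ring

lemma two_self (c : ZMod 2) : c + c = 0 := CharTwo.add_self_eq_zero c

lemma B_self (x : W) : B x x = 0 := by
  simp only [B]
  refine Finset.sum_eq_zero fun i _ => ?_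
  rw [mul_comm]; exact two_self _

lemma W_self (x : W) : x + x = 0 := ZModModule.add_self x

/-- Matrix of a transvection. -/
def tm (a : W) : Matrix (Fin 3 ⊕ Fin 3) (Fin 3 ⊕ Fin 3) (ZMod 2) := 1 + vecMulVec a (sw a)

lemma tm_mulVec (a x : W) : tm a *ᵥ x = x + B x a • a := by
  have : sw a ⬝ᵥ x = B x a := by
    simp [sw, B, dotProduct, Fintype.sum_sum_type, Fin.sum_univ_three]; ring
  rw [tm, Matrix.add_mulVec, Matrix.one_mulVec, Matrix.vecMulVec_mulVec, this]
  ext i; simp [mul_comm]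

lemma tm_mem (a : W) : tm a ∈ symplecticGroup (Fin 3) (ZMod 2) := by
  rw [SymplecticGroup.mem_iff']
  ext i j
  have h := B_mulVec (tm a) (Pi.single i 1) (Pi.single j 1)
  rw [tm_mulVec, tm_mulVec] at h
  have h2 : ∀ x y : W, B (x + B x a • a) (y + B y a • a) = B x y := by
    intro x y
    rw [B_add_left, B_add_right, B_add_right, B_smul_left, B_smul_left, B_comm x (B y a • a),
      B_comm a (B y a • a), B_smul_left, B_smul_left, B_self, B_comm a x, B_comm a y]
    linear_combination two_self (B y a * B x a)
  rw [h2, B_eq] at h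
  simpa using h.symm

/-- The transvection with centre `a`. -/
def tv (a : W) : G := ⟨tm a, tm_mem a⟩

lemma act_tv (a x : W) : act (tv a) x = x + B x a • a := tm_mulVec a x

lemma tv_conj (g : G) (a : W) : g * tv a * g⁻¹ = tv (act g a) := by
  apply act_ext
  intro x
  rw [act_mul, act_mul, act_tv, act_tv, act_add, act_act_inv, act_smul]
  rw [← B_act g, act_act_inv]

lemma tv_sq (a : W) : tv a * tv a = 1 := by
  apply act_ext
  intro x
  rw [act_mul, act_tv, act_tv, act_one, B_add_left, B_smul_left, B_self, mul_zero, add_zero,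
    add_assoc, W_self, add_zero]

lemma tv_inv (a : W) : (tv a)⁻¹ = tv a := inv_eq_of_mul_eq_one_left (tv_sq a)

lemma tv_zero : tv 0 = 1 := by
  apply act_ext
  intro x
  rw [act_tv, act_one]; simp

/-- Vectors from binary codes: bits 0-2 are the `e`-coordinates, bits 3-5 the `f`-coordinates. -/
def mk (n : ℕ) : W :=
  Sum.elim (fun i => if n.testBit i.1 then 1 else 0) (fun i => if n.testBit (i.1 + 3) then 1 else 0)

lemma mk_xor (m n : ℕ) : mk (m ^^^ n) = mk m + mk n := by
  funext i
  rcases i with i | i <;> simp only [mk, Sum.elim_inl, Sum.elim_inr, Pi.add_apply, Nat.testBit_xor]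
  · cases m.testBit i.1 <;> cases n.testBit i.1 <;> decide
  · cases m.testBit (i.1 + 3) <;> cases n.testBit (i.1 + 3) <;> decide

lemma mk_zero : mk 0 = 0 := by
  funext i
  rcases i with i | i <;> simp [mk]

/-- the form on codes. -/
def Bc (m n : ℕ) : Bool :=
  ((m.testBit 0 && n.testBit 3) ^^ (m.testBit 3 && n.testBit 0)) ^^
  (((m.testBit 1 && n.testBit 4) ^^ (m.testBit 4 && n.testBit 1)) ^^
  ((m.testBit 2 && n.testBit 5) ^^ (m.testBit 5 && n.testBit 2)))

lemma B_mk (m n : ℕ) : B (mk m) (mk n) = if Bc m n then 1 else 0 := by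
  simp only [B, mk, Bc, Fin.sum_univ_three, Sum.elim_inl, Sum.elim_inr, Fin.val_zero, Fin.val_one,
    Fin.val_two, Nat.zero_add, Nat.reduceAdd]
  have key : ∀ a b c d : Bool, ((if a then 1 else 0) * (if b then 1 else 0)
      + (if c then 1 else 0) * (if d then 1 else 0) : ZMod 2)
      = if ((a && b) ^^ (c && d)) then 1 else 0 := by decide
  have key2 : ∀ a b c : Bool, ((if a then 1 else 0) + (if b then 1 else 0)
      + (if c then 1 else 0) : ZMod 2) = if (a ^^ (b ^^ c)) then 1 else 0 := by decide
  rw [key, key, key, key2]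
  congr

set_option synthInstance.maxHeartbeats 200000 in
set_option synthInstance.maxSize 2000 in
lemma exists_mk (x : W) : ∃ n < 64, x = mk n := by
  have key : ∀ a b c d e f : ZMod 2, ∃ n : Fin 64, mk n (.inl 0) = a ∧ mk n (.inl 1) = b ∧
     mk n (.inl 2) = c ∧ mk n (.inr 0) = d ∧ mk n (.inr 1) = e ∧ mk n (.inr 2) = f := by
    decide +kernel
  obtain ⟨n, h⟩ := key (x (.inl 0)) (x (.inl 1)) (x (.inl 2)) (x (.inr 0)) (x (.inr 1))
    (x (.inr 2))
  refine ⟨n, n.2, ?_⟩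
  funext i
  rcases i with i | i <;> fin_cases i <;> simp [h]

/-- Checks that each step of the list is admissible. -/
def chk : List ℕ → List (ℕ × ℕ) → Bool
  | _, [] => true
  | k, (a, b) :: l => k.contains a && k.contains b && Bc a b && chk ((a ^^^ b) :: k) l

/-- Collects the results of the steps. -/
def res : List ℕ → List (ℕ × ℕ) → List ℕ
  | k, [] => k
  | k, (a, b) :: l => res ((a ^^^ b) :: k) l

lemma chk_sound (S : W → Prop) (hS : ∀ a b, S a → S b → B a b = 1 → S (a + b)) :
    ∀ (l : List (ℕ × ℕ)) (k : List ℕ), (∀ n ∈ k, S (mk n)) → chk k l = true →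
      ∀ n ∈ res k l, S (mk n) := by
  intro l
  induction l with
  | nil => intro k hk _ n hn; exact hk n hn
  | cons p l ih =>
    obtain ⟨a, b⟩ := p
    intro k hk hc
    simp only [chk, Bool.and_eq_true, List.contains_iff_mem] at hc
    obtain ⟨⟨⟨ha, hb⟩, hab⟩, hc⟩ := hc
    refine ih _ ?_ hc
    intro n hn
    rcases List.mem_cons.1 hn with rfl | hn
    · rw [mk_xor]
      exact hS _ _ (hk _ ha) (hk _ hb) (by rw [B_mk, hab]; rfl)
    · exact hk n hn

/-- The seven vectors forming an `E₇` diagram. -/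
def gens : List ℕ := [8, 3, 16, 2, 6, 32, 4]

/-- A sequence of reflections reaching all nonzero vectors. -/
def steps : List (ℕ × ℕ) := [(8, 3), (3, 16), (16, 2), (16, 6), (6, 32), (32, 4), (11, 16), (19, 2),
  (19, 6), (18, 6), (22, 32), (38, 4), (27, 2), (27, 6), (17, 6), (21, 32), (20, 32), (54, 4),
  (25, 6), (29, 32), (23, 16), (23, 32), (53, 4), (52, 4), (31, 16), (31, 32), (61, 4), (7, 32),
  (55, 4), (15, 3), (15, 32), (63, 4), (39, 6), (39, 4), (12, 32), (47, 6), (47, 4), (33, 4),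
  (44, 6), (44, 4), (41, 4), (37, 32), (42, 16), (42, 4), (45, 32), (58, 2), (58, 4), (46, 32),
  (56, 4), (62, 32), (60, 32), (30, 6), (28, 6), (26, 16), (10, 3), (9, 8)]

lemma tv_mul_tv_mul_tv {a b : W} (h : B a b = 1) : tv b * tv a * tv b = tv (a + b) := by
  have := tv_conj (tv b) a
  rwa [tv_inv, act_tv, h, one_smul] at this

/-- All transvections lie in a subgroup containing the seven generators. -/
lemma all_tv (K : Subgroup G) (hK : ∀ n ∈ gens, tv (mk n) ∈ K) (a : W) : tv a ∈ K := by
  have h1 := chk_sound (fun a => tv a ∈ K) (fun a b ha hb hab => by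
    rw [← tv_mul_tv_mul_tv hab]
    exact K.mul_mem (K.mul_mem hb ha) hb) steps gens hK (by decide +kernel)
  have h2 : ∀ n < 64, n = 0 ∨ n ∈ res gens steps := by decide +kernel
  obtain ⟨n, hn, rfl⟩ := exists_mk a
  rcases h2 n hn with rfl | h
  · rw [mk_zero, tv_zero]; exact K.one_mem
  · exact h1 n h

/-- codes of `e i`. -/
def e (i : Fin 3) : W := mk (2 ^ i.1)
/-- codes of `f i`. -/
def f (i : Fin 3) : W := mk (2 ^ (i.1 + 3))

lemma B_e_f (i j : Fin 3) : B (e i) (f j) = if i = j then 1 else 0 := by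
  simp only [e, f, B_mk]; revert i j; decide
lemma B_e_e (i j : Fin 3) : B (e i) (e j) = 0 := by
  simp only [e, B_mk]; revert i j; decide
lemma B_f_f (i j : Fin 3) : B (f i) (f j) = 0 := by
  simp only [f, B_mk]; revert i j; decide
lemma B_f_e (i j : Fin 3) : B (f i) (e j) = if i = j then 1 else 0 := by
  simp only [e, f, B_mk]; revert i j; decide

lemma W_ext (x : W) : x = ∑ i, (B x (f i) • e i + B x (e i) • f i) := by
  funext i
  rcases i with i | i <;> fin_cases i <;>
    simp [B, e, f, mk, Fin.sum_univ_three, Nat.testBit, Nat.shiftRight_eq_div_pow]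

set_option synthInstance.maxHeartbeats 200000 in
set_option synthInstance.maxSize 2000 in
lemma exC (k : Fin 3) (x : W) (hx : x ≠ 0) (h1 : ∀ j < k, B x (e j) = 0 ∧ B x (f j) = 0) :
    ∃ c, B x c = 1 ∧ B (e k) c = 1 ∧ ∀ j < k, B (e j) c = 0 ∧ B (f j) c = 0 := by
  obtain ⟨n, hn, rfl⟩ := exists_mk x
  have hn0 : n ≠ 0 := by rintro rfl; exact hx mk_zero
  have key : ∀ k : Fin 3, ∀ n < 64, n ≠ 0 →
      (∀ j < k, Bc n (2 ^ j.1) = false ∧ Bc n (2 ^ (j.1 + 3)) = false) →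
      ∃ c : Fin 64, Bc n c = true ∧ Bc (2 ^ k.1) c = true ∧
        ∀ j < k, Bc (2 ^ j.1) c = false ∧ Bc (2 ^ (j.1 + 3)) c = false := by
    decide +kernel
  simp only [e, f, B_mk] at h1
  obtain ⟨c, h2, h3, h4⟩ := key k n hn hn0 (by simpa using h1)
  refine ⟨mk c, ?_⟩
  simp only [e, f, B_mk]
  simpa using ⟨h2, h3, h4⟩

section gen
variable (K : Subgroup G) (hK : ∀ a, tv a ∈ K)
include hK

lemma move (a b : W) (h : B a b = 1) : ∃ g ∈ K, act g a = b ∧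
    ∀ c, B c a = B c b → act g c = c := by
  refine ⟨tv (a + b), hK _, ?_, ?_⟩
  · rw [act_tv, B_add_right, B_self, h, zero_add, one_smul, ← add_assoc, W_self, zero_add]
  · intro c hc
    rw [act_tv, B_add_right, hc, two_self, zero_smul, add_zero]

lemma red (k : Fin 3) (a b : W) (h : B a b = 1)
    (ha : ∀ j < k, B a (e j) = 0 ∧ B a (f j) = 0) (hb : ∀ j < k, B b (e j) = 0 ∧ B b (f j) = 0) :
    ∃ g ∈ K, act g a = e k ∧ act g b = f k ∧ ∀ j < k, act g (e j) = e j ∧ act g (f j) = f j := by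
  have ha0 : a ≠ 0 := by
    rintro rfl
    simp [B] at h
  obtain ⟨c, h1, h2, h3⟩ := exC k a ha0 ha
  obtain ⟨g1, hg1, k1, k2⟩ := move K hK a c h1
  obtain ⟨g2, hg2, k3, k4⟩ := move K hK c (e k) (by rw [B_comm, h2])
  have fix12 : ∀ j < k, act (g2 * g1) (e j) = e j ∧ act (g2 * g1) (f j) = f j := by
    intro j hj
    constructor
    · rw [act_mul, k2, k4]
      · rw [(h3 j hj).1, B_e_e]
      · rw [(h3 j hj).1, B_comm, (ha j hj).1]
    · rw [act_mul, k2, k4]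
      · rw [(h3 j hj).2, B_f_e, if_neg hj.ne]
      · rw [(h3 j hj).2, B_comm, (ha j hj).2]
  have ha' : act (g2 * g1) a = e k := by rw [act_mul, k1, k3]
  set y := act (g2 * g1) b with hy
  have hy1 : B (e k) y = 1 := by rw [← ha', hy, B_act, h]
  have hy2 : ∀ j < k, B (e j) y = 0 ∧ B (f j) y = 0 := by
    intro j hj
    rw [← (fix12 j hj).1, ← (fix12 j hj).2, hy, B_act, B_act, B_comm, B_comm (f j)]
    exact hb j hj
  have fin : ∃ g ∈ K, act g (e k) = e k ∧ act g y = f k ∧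
      ∀ j < k, act g (e j) = e j ∧ act g (f j) = f j := by
    rcases (show ∀ c : ZMod 2, c = 1 ∨ c = 0 by decide) (B y (f k)) with hc | hc
    · obtain ⟨g, hg, l1, l2⟩ := move K hK y (f k) hc
      refine ⟨g, hg, l2 _ ?_, l1, fun j hj => ⟨l2 _ ?_, l2 _ ?_⟩⟩
      · rw [hy1, B_e_f, if_pos rfl]
      · rw [(hy2 j hj).1, B_e_f, if_neg hj.ne]
      · rw [(hy2 j hj).2, B_f_f]
    · obtain ⟨g, hg, l1, l2⟩ := move K hK y (e k + f k) (by
        rw [B_add_right, hc, B_comm, hy1, add_zero])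
      obtain ⟨g', hg', m1, m2⟩ := move K hK (e k + f k) (f k) (by
        rw [B_add_left, B_e_f, B_f_f, if_pos rfl, add_zero])
      refine ⟨g' * g, K.mul_mem hg' hg, ?_, ?_, fun j hj => ⟨?_, ?_⟩⟩
      · rw [act_mul, l2, m2]
        · rw [B_add_right, B_e_e, zero_add]
        · rw [B_add_right, B_e_e, zero_add, hy1, B_e_f, if_pos rfl]
      · rw [act_mul, l1, m1]
      · rw [act_mul, l2, m2]
        · rw [B_add_right, B_e_e, zero_add]
        · rw [B_add_right, B_e_e, zero_add, (hy2 j hj).1, B_e_f, if_neg hj.ne]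
      · rw [act_mul, l2, m2]
        · rw [B_add_right, B_f_e, if_neg hj.ne, zero_add]
        · rw [B_add_right, B_f_e, if_neg hj.ne, zero_add, (hy2 j hj).2, B_f_f]
  obtain ⟨g, hg, l1, l2, l3⟩ := fin
  refine ⟨g * (g2 * g1), K.mul_mem hg (K.mul_mem hg2 hg1), ?_, ?_, fun j hj => ⟨?_, ?_⟩⟩
  · rw [act_mul, ha', l1]
  · rw [act_mul, ← hy, l2]
  · rw [act_mul, (fix12 j hj).1, (l3 j hj).1]
  · rw [act_mul, (fix12 j hj).2, (l3 j hj).2]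

/-- Transitivity on symplectic bases. -/
lemma frame (a b : Fin 3 → W) (hab : ∀ i j, B (a i) (b j) = if i = j then 1 else 0)
    (haa : ∀ i j, B (a i) (a j) = 0) (hbb : ∀ i j, B (b i) (b j) = 0) :
    ∃ g ∈ K, ∀ i, act g (a i) = e i ∧ act g (b i) = f i := by
  have hba : ∀ i j, B (b i) (a j) = if i = j then 1 else 0 := fun i j => by
    rw [B_comm, hab]; simp [eq_comm]
  have step : ∀ n : ℕ, n ≤ 3 → ∃ g ∈ K, ∀ i : Fin 3, i.1 < n →
      act g (a i) = e i ∧ act g (b i) = f i := by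
    intro n
    induction n with
    | zero => intro _; exact ⟨1, K.one_mem, fun i hi => absurd hi (by omega)⟩
    | succ n ih =>
      intro hn
      obtain ⟨g, hg, h⟩ := ih (by omega)
      have hlt : ∀ j : Fin 3, j < (⟨n, by omega⟩ : Fin 3) → j.1 < n := fun j hj => hj
      obtain ⟨g', hg', k1, k2, k3⟩ := red K hK ⟨n, by omega⟩ (act g (a ⟨n, by omega⟩))
        (act g (b ⟨n, by omega⟩)) (by rw [B_act, hab, if_pos rfl])
        (fun j hj => by
          rw [← (h j (hlt j hj)).1, ← (h j (hlt j hj)).2, B_act, B_act, haa, hab, if_neg hj.ne']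
          exact ⟨rfl, rfl⟩)
        (fun j hj => by
          rw [← (h j (hlt j hj)).1, ← (h j (hlt j hj)).2, B_act, B_act, hbb, hba, if_neg hj.ne']
          exact ⟨rfl, rfl⟩)
      refine ⟨g' * g, K.mul_mem hg' hg, fun i hi => ?_⟩
      rw [act_mul, act_mul]
      rcases Nat.lt_succ_iff_lt_or_eq.1 hi with hi | hi
      · rw [(h i hi).1, (h i hi).2]
        exact k3 i hi
      · have : i = ⟨n, by omega⟩ := Fin.ext hi
        rw [this]
        exact ⟨k1, k2⟩
  obtain ⟨g, hg, h⟩ := step 3 le_rfl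
  exact ⟨g, hg, fun i => h i i.2⟩

lemma gen_top : K = ⊤ := by
  rw [eq_top_iff]
  intro g _
  obtain ⟨h, hh, H⟩ := frame K hK (fun i => act g (e i)) (fun i => act g (f i))
    (fun i j => by rw [B_act, B_e_f]) (fun i j => by rw [B_act, B_e_e])
    (fun i j => by rw [B_act, B_f_f])
  have : h * g = 1 := by
    apply act_ext
    intro x
    have lin : ∀ y : G, act y x = ∑ i, (B x (f i) • act y (e i) + B x (e i) • act y (f i)) := by
      intro y
      conv_lhs => rw [W_ext x]
      simp only [Fin.sum_univ_three, act_add, act_smul]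
    rw [lin, lin]
    refine Finset.sum_congr rfl fun i _ => ?_
    rw [act_mul, act_mul, (H i).1, (H i).2, act_one, act_one]
  rw [← inv_eq_of_mul_eq_one_right this]
  exact K.inv_mem hh
end gen

/-- The seven transvections generate. -/
lemma gens_top (K : Subgroup G) (hK : ∀ n ∈ gens, tv (mk n) ∈ K) : K = ⊤ :=
  gen_top K (all_tv K hK)

lemma frame' (a b : Fin 3 → W) (hab : ∀ i j, B (a i) (b j) = if i = j then 1 else 0)
    (haa : ∀ i j, B (a i) (a j) = 0) (hbb : ∀ i j, B (b i) (b j) = 0) :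
    ∃ g : G, ∀ i, act g (e i) = a i ∧ act g (f i) = b i := by
  obtain ⟨g, -, h⟩ := frame ⊤ (fun _ => trivial) a b hab haa hbb
  refine ⟨g⁻¹, fun i => ?_⟩
  rw [← (h i).1, ← (h i).2, act_inv_act, act_inv_act]
  exact ⟨rfl, rfl⟩

lemma pair' (a b : W) (hab : B a b = 1) : ∃ g : G, act g (e 0) = a ∧ act g (f 0) = b := by
  obtain ⟨g, -, h1, h2, -⟩ := red ⊤ (fun _ => trivial) 0 a b hab
    (fun j hj => absurd hj (Fin.not_lt_zero j)) (fun j hj => absurd hj (Fin.not_lt_zero j))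
  refine ⟨g⁻¹, ?_⟩
  rw [← h1, ← h2, act_inv_act, act_inv_act]
  exact ⟨rfl, rfl⟩

end Sp6

namespace Sp6

open Matrix

section linear
open Module
variable {V : Type*} [AddCommGroup V] [Module (ZMod 2) V]

lemma V_self (x : V) : x + x = 0 := ZModModule.add_self x

lemma V_eq {x y : V} (h : x + y = 0) : x = y := by
  rw [← sub_eq_zero, ZModModule.sub_eq_add, h]

/-- Fixed points. -/
def Fx (z : V →ₗ[ZMod 2] V) : Submodule (ZMod 2) V := LinearMap.ker (z + LinearMap.id)

/-- The `t`-fixed points of the nontrivial part for `z`. -/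
def Dx (z t : V →ₗ[ZMod 2] V) : Submodule (ZMod 2) V :=
  LinearMap.ker (LinearMap.id + z + z ∘ₗ z) ⊓ Fx t

lemma mem_Fx {z : V →ₗ[ZMod 2] V} {v : V} : v ∈ Fx z ↔ z v = v := by
  simp only [Fx, LinearMap.mem_ker, LinearMap.add_apply, LinearMap.id_apply]
  exact ⟨V_eq, fun h => by rw [h, V_self]⟩

lemma mem_Dx {z t : V →ₗ[ZMod 2] V} {v : V} :
    v ∈ Dx z t ↔ v + z v + z (z v) = 0 ∧ t v = v := by
  simp [Dx, Submodule.mem_inf, mem_Fx]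

/-- A pair of endomorphisms satisfying the relations of the symmetric group of degree 3. -/
structure S3 (z t : V →ₗ[ZMod 2] V) : Prop where
  hz : ∀ v, z (z (z v)) = v
  ht : ∀ v, t (t v) = v
  hzt : ∀ v, t (z v) = z (z (t v))

variable {z t : V →ₗ[ZMod 2] V}

lemma S3.t_mem_Fx (h : S3 z t) {v : V} (hv : v ∈ Fx z) : t v ∈ Fx z := by
  rw [mem_Fx] at *
  have := h.hzt v
  rw [hv] at this
  conv_lhs => rw [this, h.hz]

lemma Fx_inf_Dx : Fx z ⊓ Dx z t = ⊥ := by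
  rw [eq_bot_iff]
  rintro v ⟨h1, h2⟩
  have h1 := mem_Fx.1 h1
  have h2 := (mem_Dx.1 h2).1
  rw [h1, h1, V_self, zero_add] at h2
  exact h2

lemma S3.split (h : S3 z t) (N : Submodule (ZMod 2) V) (hNz : ∀ v ∈ N, z v ∈ N)
    (hNt : ∀ v ∈ N, t v ∈ N) (v : V) (hv : v ∈ N) :
    ∃ x ∈ N ⊓ Fx z, ∃ a ∈ N ⊓ Dx z t, ∃ b ∈ N ⊓ Dx z t, v = x + a + z b := by
  have e1 := V_self v
  have e2 := V_self (z v)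
  have e3 := V_self (z (z v))
  have e4 := V_self (t v)
  have e5 := V_self (z (t v))
  have e6 := V_self (z (z (t v)))
  refine ⟨v + z v + z (z v), ⟨?_, ?_⟩, z v + v + (t v + z (z (t v))), ⟨?_, ?_⟩,
    z v + z (z v) + (z (t v) + z (z (t v))), ⟨?_, ?_⟩, ?_⟩
  · exact N.add_mem (N.add_mem hv (hNz _ hv)) (hNz _ (hNz _ hv))
  · rw [SetLike.mem_coe, mem_Fx]
    simp only [map_add, h.hz]
    abel
  · have := hNt _ hv
    have := hNz _ hv
    have := hNz _ (hNz _ (hNt _ hv))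
    exact N.add_mem (N.add_mem ‹_› ‹_›) (N.add_mem ‹_› ‹_›)
  · rw [SetLike.mem_coe, mem_Dx]
    simp only [map_add, h.hz, h.ht, h.hzt]
    constructor
    · linear_combination (norm := module) e1 + e2 + e3 + e4 + e5 + e6
    · abel
  · have := hNz _ hv
    have := hNz _ (hNz _ hv)
    have := hNz _ (hNt _ hv)
    have := hNz _ (hNz _ (hNt _ hv))
    exact N.add_mem (N.add_mem ‹_› ‹_›) (N.add_mem ‹_› ‹_›)
  · rw [SetLike.mem_coe, mem_Dx]
    simp only [map_add, h.hz, h.ht, h.hzt]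
    constructor
    · linear_combination (norm := module) e1 + e2 + e3 + e4 + e5 + e6
    · abel
  · simp only [map_add, h.hz]
    linear_combination (norm := module) -e1 - e2 - e3 - e4 - e6

lemma S3.finrank (h : S3 z t) [FiniteDimensional (ZMod 2) V] (N : Submodule (ZMod 2) V)
    (hNz : ∀ v ∈ N, z v ∈ N) (hNt : ∀ v ∈ N, t v ∈ N) :
    finrank (ZMod 2) N = finrank (ZMod 2) ↥(N ⊓ Fx z) + 2 * finrank (ZMod 2) ↥(N ⊓ Dx z t) := by
  let φ : (↥(N ⊓ Fx z) × ↥(N ⊓ Dx z t) × ↥(N ⊓ Dx z t)) →ₗ[ZMod 2] V :=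
    LinearMap.coprod (N ⊓ Fx z).subtype
      (LinearMap.coprod (N ⊓ Dx z t).subtype (z ∘ₗ (N ⊓ Dx z t).subtype))
  have hφ : ∀ x a b, φ (x, a, b) = x.1 + (a.1 + z b.1) := fun x a b => rfl
  have hinj : Function.Injective φ := by
    rw [← LinearMap.ker_eq_bot, LinearMap.ker_eq_bot']
    rintro ⟨⟨x, hx⟩, ⟨a, ha⟩, ⟨b, hb⟩⟩ hm
    rw [hφ] at hm
    simp only at hm
    have hx' := mem_Fx.1 hx.2
    have ha' := mem_Dx.1 ha.2
    have hb' := mem_Dx.1 hb.2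
    have hm1 := congrArg z hm
    have hm2 := congrArg z hm1
    simp only [map_add, map_zero, hx', h.hz] at hm1 hm2
    have hx0 : x = 0 := by
      linear_combination (norm := module) hm + hm1 + hm2 - ha'.1 - hb'.1 - V_self x
    rw [hx0, zero_add] at hm
    have hm3 := congrArg t hm
    simp only [map_add, map_zero, h.hzt, ha'.2, hb'.2] at hm3
    have hb0 : b = 0 := by
      linear_combination (norm := module) hb'.1 - hm - hm3 + V_self a
    have ha0 : a = 0 := by rw [hb0] at hm; simpa using hm
    subst hx0 ha0 hb0
    rfl
  have hrange : LinearMap.range φ = N := by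
    apply le_antisymm
    · rintro _ ⟨⟨x, a, b⟩, rfl⟩
      rw [hφ]
      exact N.add_mem x.2.1 (N.add_mem a.2.1 (hNz _ b.2.1))
    · intro v hv
      obtain ⟨x, hx, a, ha, b, hb, rfl⟩ := h.split N hNz hNt v hv
      exact ⟨(⟨x, hx⟩, ⟨a, ha⟩, ⟨b, hb⟩), by rw [hφ, add_assoc]⟩
  have := LinearMap.finrank_range_of_inj hinj
  rw [hrange, finrank_prod, finrank_prod] at this
  omega

lemma one_dim (N : Submodule (ZMod 2) V) [FiniteDimensional (ZMod 2) N]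
    (hN : finrank (ZMod 2) N ≤ 1) {x y : V}
    (hx : x ∈ N) (hy : y ∈ N) (hx0 : x ≠ 0) (hy0 : y ≠ 0) : x = y := by
  obtain ⟨v, hv⟩ := finrank_le_one_iff.1 hN
  have key : ∀ w ∈ N, w ≠ 0 → w = v.1 := by
    intro w hw hw0
    obtain ⟨c, hc⟩ := hv ⟨w, hw⟩
    have hc := congrArg Subtype.val hc
    rcases (show ∀ c : ZMod 2, c = 1 ∨ c = 0 by decide) c with rfl | rfl
    · simpa using hc.symm
    · simp at hc; exact absurd hc.symm hw0
  rw [key x hx hx0, key y hy hy0]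

/-- Three commuting copies of the symmetric group of degree 3. -/
structure Tri (z t : Fin 3 → V →ₗ[ZMod 2] V) : Prop where
  s3 : ∀ i, S3 (z i) (t i)
  zz : ∀ i j, i ≠ j → ∀ v, z i (z j v) = z j (z i v)
  tt : ∀ i j, i ≠ j → ∀ v, t i (t j v) = t j (t i v)
  zt : ∀ i j, i ≠ j → ∀ v, z i (t j v) = t j (z i v)

namespace Tri
variable {z t : Fin 3 → V →ₗ[ZMod 2] V} (H : Tri z t)

/-- Either the fixed space or the `t`-fixed nontrivial part. -/
def X (z t : Fin 3 → V →ₗ[ZMod 2] V) (p : Bool) (i : Fin 3) : Submodule (ZMod 2) V :=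
  if p then Dx (z i) (t i) else Fx (z i)

/-- The dimensions of the pieces. -/
noncomputable def d (z t : Fin 3 → V →ₗ[ZMod 2] V) (p q r : Bool) : ℕ :=
  finrank (ZMod 2) ↥(X z t p 0 ⊓ X z t q 1 ⊓ X z t r 2)

include H

lemma Xz (p : Bool) {i j : Fin 3} (hij : i ≠ j) (v : V) (hv : v ∈ X z t p i) :
    z j v ∈ X z t p i := by
  cases p
  · simp only [X, Bool.false_eq_true, if_false, mem_Fx] at *
    rw [H.zz i j hij, hv]
  · simp only [X, if_true, mem_Dx] at *
    rw [H.zz i j hij, H.zz i j hij, ← map_add, ← map_add, hv.1, map_zero, ← H.zt j i hij.symm,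
      hv.2]
    exact ⟨rfl, rfl⟩

lemma Xt (p : Bool) {i j : Fin 3} (hij : i ≠ j) (v : V) (hv : v ∈ X z t p i) :
    t j v ∈ X z t p i := by
  cases p
  · simp only [X, Bool.false_eq_true, if_false, mem_Fx] at *
    rw [H.zt i j hij, hv]
  · simp only [X, if_true, mem_Dx] at *
    rw [H.zt i j hij, H.zt i j hij, ← map_add, ← map_add, hv.1, map_zero, H.tt i j hij,
      hv.2]
    exact ⟨rfl, rfl⟩

variable [FiniteDimensional (ZMod 2) V]

lemma fin (i : Fin 3) (N : Submodule (ZMod 2) V)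
    (hNz : ∀ v ∈ N, z i v ∈ N) (hNt : ∀ v ∈ N, t i v ∈ N) : finrank (ZMod 2) N =
    finrank (ZMod 2) ↥(N ⊓ X z t false i) + 2 * finrank (ZMod 2) ↥(N ⊓ X z t true i) :=
  (H.s3 i).finrank N hNz hNt

lemma fin1 (p : Bool) {i j : Fin 3} (hij : i ≠ j) : finrank (ZMod 2) (X z t p i) =
    finrank (ZMod 2) ↥(X z t p i ⊓ X z t false j)
      + 2 * finrank (ZMod 2) ↥(X z t p i ⊓ X z t true j) :=
  H.fin j _ (fun v => H.Xz p hij v) (fun v => H.Xt p hij v)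

lemma fin2 (p q : Bool) {i j k : Fin 3} (hik : i ≠ k) (hjk : j ≠ k) :
    finrank (ZMod 2) ↥(X z t p i ⊓ X z t q j) =
    finrank (ZMod 2) ↥(X z t p i ⊓ X z t q j ⊓ X z t false k)
      + 2 * finrank (ZMod 2) ↥(X z t p i ⊓ X z t q j ⊓ X z t true k) :=
  H.fin k _ (fun v hv => ⟨H.Xz p hik v hv.1, H.Xz q hjk v hv.2⟩)
    (fun v hv => ⟨H.Xt p hik v hv.1, H.Xt q hjk v hv.2⟩)

lemma fin01 (p q : Bool) :
    finrank (ZMod 2) ↥(X z t p 0 ⊓ X z t q 1) = d z t p q false + 2 * d z t p q true :=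
  H.fin2 p q (by decide) (by decide)

lemma fin02 (p r : Bool) :
    finrank (ZMod 2) ↥(X z t p 0 ⊓ X z t r 2) = d z t p false r + 2 * d z t p true r := by
  rw [H.fin2 p r (k := 1) (by decide) (by decide), d, d, inf_right_comm,
    inf_right_comm _ (X z t r 2)]

lemma fin12 (q r : Bool) :
    finrank (ZMod 2) ↥(X z t q 1 ⊓ X z t r 2) = d z t false q r + 2 * d z t true q r := by
  rw [H.fin2 q r (k := 0) (by decide) (by decide), d, d, inf_comm, inf_comm _ (X z t true 0),
    inf_assoc, inf_assoc]

lemma finV : finrank (ZMod 2) V = d z t false false false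
    + 2 * (d z t true false false + d z t false true false + d z t false false true)
    + 4 * (d z t true true false + d z t false true true + d z t true false true)
    + 8 * d z t true true true := by
  have h := H.fin 0 ⊤ (fun _ _ => trivial) (fun _ _ => trivial)
  rw [top_inf_eq, top_inf_eq, finrank_top, H.fin1 (j := 1) false (by decide),
    H.fin1 (j := 1) true (by decide), H.fin01, H.fin01, H.fin01, H.fin01] at h
  omega

/-- The three possibilities in dimension 8. -/
lemma cases (hV : finrank (ZMod 2) V = 8) (s1 : ∀ p q r, d z t p q r = d z t q p r)
    (s2 : ∀ p q r, d z t p q r = d z t p r q) :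
    (∀ i, Fx (z i) = ⊥) ∨ (Fx (z 0) = ⊤) ∨
    ((∀ i, finrank (ZMod 2) ↥(Dx (z i) (t i)) ≤ 1) ∧
      (∀ i j, i ≠ j → Dx (z i) (t i) ⊓ Dx (z j) (t j) = ⊥) ∧
      finrank (ZMod 2) ↥(Fx (z 0) ⊓ Fx (z 1) ⊓ Fx (z 2)) = 2) := by
  have h := H.finV
  have a1 := s1 true false false
  have a2 := s2 false true false
  have a3 := s1 true false true
  have a4 := s2 true true false
  have f0 (p) := H.fin1 (i := 0) (j := 1) p (by decide)
  have f1 (p) := H.fin1 (i := 1) (j := 2) p (by decide)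
  have f2 (p) := H.fin1 (i := 2) (j := 0) p (by decide)
  have sy : ∀ p q i j, finrank (ZMod 2) ↥(X z t p i ⊓ X z t q j) =
      finrank (ZMod 2) ↥(X z t q j ⊓ X z t p i) := fun p q i j => by rw [inf_comm]
  simp only [H.fin01, H.fin12, sy _ _ 2 0, H.fin02] at f0 f1 f2
  have f0t := f0 true
  have f1t := f1 true
  have f2t := f2 true
  have f0f := f0 false
  have f1f := f1 false
  have f2f := f2 false
  have g01 := H.fin01 true true
  have g02 := H.fin02 true true
  have g12 := H.fin12 true true
  have g10 := sy true true 1 0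
  have g20 := sy true true 2 0
  have g21 := sy true true 2 1
  rcases Nat.eq_zero_or_pos (d z t true true true) with h3 | h3
  · right
    rcases Nat.eq_zero_or_pos (d z t true false false) with h1 | h1
    · left
      refine Submodule.eq_top_of_finrank_eq ?_
      change finrank (ZMod 2) (X z t false 0) = _
      omega
    · right
      refine ⟨?_, ?_, ?_⟩
      · intro i
        change finrank (ZMod 2) (X z t true i) ≤ 1
        fin_cases i <;> dsimp only [Fin.zero_eta, Fin.mk_one, Fin.reduceFinMk] <;> omega
      · intro i j hij
        change X z t true i ⊓ X z t true j = ⊥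
        rw [← Submodule.finrank_eq_zero (R := ZMod 2)]
        fin_cases i <;> fin_cases j <;>
          dsimp only [Fin.zero_eta, Fin.mk_one, Fin.reduceFinMk] at hij ⊢ <;>
          first
          | exact absurd rfl hij
          | omega
      · change d z t false false false = 2
        omega
  · left
    intro i
    change X z t false i = ⊥
    rw [← Submodule.finrank_eq_zero (R := ZMod 2)]
    fin_cases i <;> dsimp only [Fin.zero_eta, Fin.mk_one, Fin.reduceFinMk] <;> omega


section caseC
variable (h1 : ∀ i, finrank (ZMod 2) ↥(Dx (z i) (t i)) ≤ 1)
  (h2 : ∀ i j, i ≠ j → Dx (z i) (t i) ⊓ Dx (z j) (t j) = ⊥)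
include h2

omit [FiniteDimensional (ZMod 2) V] in
lemma D_le_F {i j : Fin 3} (hij : i ≠ j) : Dx (z i) (t i) ≤ Fx (z j) := by
  intro w hw
  obtain ⟨x, hx, a, ha, b, hb, h⟩ := (H.s3 j).split (Dx (z i) (t i))
    (fun v => H.Xz true hij v) (fun v => H.Xt true hij v) w hw
  rw [h2 i j hij, Submodule.mem_bot] at ha hb
  rw [ha, hb, map_zero, add_zero, add_zero] at h
  rw [h]
  exact hx.2

omit h2 in
include h1 in
lemma t_fix {i j : Fin 3} (hij : i ≠ j) {b : V} (hb : b ∈ Dx (z j) (t j)) : t i b = b := by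
  by_cases h0 : b = 0
  · rw [h0, map_zero]
  · refine one_dim _ (h1 j) (H.Xt true hij.symm b hb) hb ?_ h0
    intro h
    apply h0
    rw [← (H.s3 i).ht b, h, map_zero]

omit h2 in
include h1 in
lemma diff_mem (i j : Fin 3) {a b : V} (ha : a ∈ Dx (z j) (t j)) (hb : b ∈ Dx (z j) (t j)) :
    (a + z j b) + t i (a + z j b) ∈ Dx (z i) (t i) := by
  by_cases hij : i = j
  · subst hij
    have e : (a + z i b) + t i (a + z i b) = b := by
      rw [map_add, (H.s3 i).hzt, (mem_Dx.1 ha).2, (mem_Dx.1 hb).2]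
      have := (mem_Dx.1 hb).1
      linear_combination (norm := module) this + V_self a - V_self b
    rw [e]
    exact hb
  · rw [map_add, ← H.zt j i (Ne.symm hij), H.t_fix h1 hij ha, H.t_fix h1 hij hb, V_self]
    exact Submodule.zero_mem _

omit h2 in
include h1 in
lemma decomp (i : Fin 3) (v : V) : ∃ x ∈ Fx (z 0) ⊓ Fx (z 1) ⊓ Fx (z 2), ∃ b ∈ Dx (z i) (t i),
    v + t i v = (x + t i x) + b := by
  obtain ⟨x0, hx0, a0, ha0, b0, hb0, rfl⟩ := (H.s3 0).split ⊤ (fun _ _ => trivial)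
    (fun _ _ => trivial) v trivial
  obtain ⟨x1, hx1, a1, ha1, b1, hb1, rfl⟩ := (H.s3 1).split (Fx (z 0))
    (fun v => H.Xz false (by decide) v) (fun v => H.Xt false (by decide) v) x0 hx0.2
  obtain ⟨x2, hx2, a2, ha2, b2, hb2, rfl⟩ := (H.s3 2).split (Fx (z 0) ⊓ Fx (z 1))
    (fun v hv => ⟨H.Xz false (by decide) v hv.1, H.Xz false (by decide) v hv.2⟩)
    (fun v hv => ⟨H.Xt false (by decide) v hv.1, H.Xt false (by decide) v hv.2⟩) x1 hx1
  refine ⟨x2, hx2, _, Submodule.add_mem _ (H.diff_mem h1 i 0 ha0.2 hb0.2)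
    (Submodule.add_mem _ (H.diff_mem h1 i 1 ha1.2 hb1.2) (H.diff_mem h1 i 2 ha2.2 hb2.2)), ?_⟩
  simp only [map_add]
  abel

omit [FiniteDimensional (ZMod 2) V] h2 in
lemma U_t (i : Fin 3) {x : V} (hx : x ∈ Fx (z 0) ⊓ Fx (z 1) ⊓ Fx (z 2)) :
    t i x ∈ Fx (z 0) ⊓ Fx (z 1) ⊓ Fx (z 2) := by
  have key : ∀ j, x ∈ Fx (z j) → t i x ∈ Fx (z j) := by
    intro j hj
    by_cases hij : j = i
    · subst hij; exact (H.s3 j).t_mem_Fx hj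
    · exact H.Xt false hij x hj
  exact ⟨⟨key 0 hx.1.1, key 1 hx.1.2⟩, key 2 hx.2⟩

omit h2 in
/-- If every `t i` acts nontrivially on the common fixed space, then a common vector arises. -/
lemma exists_u (h3 : finrank (ZMod 2) ↥(Fx (z 0) ⊓ Fx (z 1) ⊓ Fx (z 2)) = 2)
    (h4 : ∀ i, ∃ x ∈ Fx (z 0) ⊓ Fx (z 1) ⊓ Fx (z 2), t i x ≠ x) :
    ∃ u, u ≠ 0 ∧ (∀ i, ∃ x ∈ Fx (z 0) ⊓ Fx (z 1) ⊓ Fx (z 2), u = x + t i x) ∧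
      (∀ i, ∀ x ∈ Fx (z 0) ⊓ Fx (z 1) ⊓ Fx (z 2), x + t i x = 0 ∨ x + t i x = u) := by
  set U := Fx (z 0) ⊓ Fx (z 1) ⊓ Fx (z 2) with hU
  have hk : ∀ i, finrank (ZMod 2) ↥(U ⊓ Fx (t i)) ≤ 1 := by
    intro i
    have : U ⊓ Fx (t i) < U := by
      refine lt_of_le_of_ne inf_le_left ?_
      intro h
      obtain ⟨x, hx, hx'⟩ := h4 i
      rw [← h] at hx
      exact hx' (mem_Fx.1 hx.2)
    have := Submodule.finrank_lt_finrank_of_lt this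
    omega
  have hd : ∀ i, ∀ x ∈ U, x + t i x ∈ U ⊓ Fx (t i) := by
    intro i x hx
    refine ⟨U.add_mem hx (H.U_t i hx), ?_⟩
    rw [SetLike.mem_coe, mem_Fx, map_add, (H.s3 i).ht, add_comm]
  have hne : ∀ i x, t i x ≠ x → x + t i x ≠ 0 := fun i x h h' => h (V_eq h').symm
  choose x hx hx' using h4
  have heq : ∀ i j, x i + t i (x i) = x j + t j (x j) := by
    intro i j
    by_cases hij : i = j
    · rw [hij]
    · have hfix : t i (x j + t j (x j)) = x j + t j (x j) := by
        refine one_dim _ (hk j) ?_ (hd j _ (hx j)) ?_ (hne _ _ (hx' j))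
        · rw [map_add, H.tt i j hij]
          exact hd j _ (H.U_t i (hx j))
        · intro h
          apply hne _ _ (hx' j)
          rw [← (H.s3 i).ht (x j + _), h, map_zero]
      exact one_dim _ (hk i) (hd i _ (hx i)) ⟨(hd j _ (hx j)).1, mem_Fx.2 hfix⟩
        (hne _ _ (hx' i)) (hne _ _ (hx' j))
  refine ⟨x 0 + t 0 (x 0), hne _ _ (hx' 0), fun i => ⟨x i, hx i, heq 0 i⟩, fun i y hy => ?_⟩
  by_cases hy0 : y + t i y = 0
  · exact Or.inl hy0
  · right
    rw [heq 0 i]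
    exact one_dim _ (hk i) (hd i _ hy) (hd i _ (hx i)) hy0 (hne _ _ (hx' i))

include h1 in
lemma inter {u : V}
    (h5 : ∀ i, ∀ x ∈ Fx (z 0) ⊓ Fx (z 1) ⊓ Fx (z 2), x + t i x = 0 ∨ x + t i x = u)
    {v w y : V} (hv : y = v + t 0 v) (hw : y = w + t 2 w) : y = 0 ∨ y = u := by
  obtain ⟨x, hx, b, hb, e1⟩ := H.decomp h1 0 v
  obtain ⟨x', hx', c, hc, e2⟩ := H.decomp h1 2 w
  rw [← hv] at e1
  rw [← hw] at e2
  have k1 := (Fx (z 2)).add_mem (Submodule.add_mem _ hx.2 (H.U_t 0 hx).2)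
    (H.D_le_F h2 (by decide) hb)
  rw [← e1, e2] at k1
  have k2 : c ∈ Fx (z 2) := by
    have := Submodule.sub_mem _ k1 (Submodule.add_mem _ hx'.2 (H.U_t 2 hx').2)
    rwa [add_sub_cancel_left] at this
  have k3 : c = 0 := by
    have : c ∈ Fx (z 2) ⊓ Dx (z 2) (t 2) := ⟨k2, hc⟩
    rwa [Fx_inf_Dx, Submodule.mem_bot] at this
  rw [e2, k3, add_zero]
  exact h5 2 x' hx'

end caseC

end Tri

end linear
end Sp6

namespace Sp6

open Matrix

lemma tv_comm {a b : W} (h : B a b = 0) : Commute (tv a) (tv b) := by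
  have := tv_conj (tv b) a
  rw [act_tv, h, zero_smul, add_zero, mul_inv_eq_iff_eq_mul] at this
  exact this.symm

lemma braid {a b : W} (h : B a b = 1) : tv a * tv b * tv a = tv b * tv a * tv b := by
  rw [tv_mul_tv_mul_tv h, tv_mul_tv_mul_tv (by rw [B_comm, h]), add_comm]

lemma z_cube {a b : W} (h : B a b = 1) :
    (tv a * tv b) * ((tv a * tv b) * (tv a * tv b)) = 1 := by
  calc _ = (tv a * tv b * tv a) * (tv b * tv a * tv b) := by group
    _ = (tv a * tv b * tv a) * (tv a * tv b * tv a) := by rw [braid h]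
    _ = tv a * tv b * (tv a * tv a) * tv b * tv a := by group
    _ = tv a * (tv b * tv b) * tv a := by rw [tv_sq]; group
    _ = 1 := by rw [tv_sq, mul_one, tv_sq]

lemma t_z {a b : W} (h : B a b = 1) :
    tv a * (tv a * tv b) = (tv a * tv b) * ((tv a * tv b) * tv a) := by
  have e1 : tv a * (tv a * tv b) = tv b := by rw [← mul_assoc, tv_sq, one_mul]
  have e2 : (tv a * tv b) * ((tv a * tv b) * tv a) = tv b := by
    calc _ = (tv a * tv b * tv a) * tv b * tv a := by group
      _ = tv b * tv a * (tv b * tv b) * tv a := by rw [braid h]; group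
      _ = tv b * (tv a * tv a) := by rw [tv_sq]; group
      _ = tv b := by rw [tv_sq, mul_one]
  rw [e1, e2]

/-- The order-3 element attached to the `i`-th hyperbolic plane. -/
def zg (i : Fin 3) : G := tv (e i) * tv (f i)

lemma permG (π : Equiv.Perm (Fin 3)) :
    ∃ g : G, ∀ i, act g (e i) = e (π i) ∧ act g (f i) = f (π i) :=
  frame' (fun i => e (π i)) (fun i => f (π i)) (fun i j => by rw [B_e_f]; simp)
    (fun i j => B_e_e _ _) (fun i j => B_f_f _ _)

section rep
open Module
variable {V : Type*} [AddCommGroup V] [Module (ZMod 2) V] (ρ : Representation (ZMod 2) G V)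

lemma rho_mul (g h : G) (v : V) : ρ g (ρ h v) = ρ (g * h) v := by rw [map_mul]; rfl

lemma rho_inv (g : G) (v : V) : ρ g⁻¹ (ρ g v) = v := by
  rw [rho_mul, inv_mul_cancel, map_one]; rfl

lemma rho_inv' (g : G) (v : V) : ρ g (ρ g⁻¹ v) = v := by
  rw [rho_mul, mul_inv_cancel, map_one]; rfl

/-- images of the order-3 elements -/
abbrev zr (i : Fin 3) : V →ₗ[ZMod 2] V := ρ (zg i)
/-- images of the transvections -/
abbrev tr (i : Fin 3) : V →ₗ[ZMod 2] V := ρ (tv (e i))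

lemma ee_comm (i j : Fin 3) : Commute (tv (e i)) (tv (e j)) := tv_comm (B_e_e i j)
lemma ff_comm (i j : Fin 3) : Commute (tv (f i)) (tv (f j)) := tv_comm (B_f_f i j)
lemma ef_comm {i j : Fin 3} (h : i ≠ j) : Commute (tv (e i)) (tv (f j)) :=
  tv_comm (by rw [B_e_f, if_neg h])
lemma zt_comm {i j : Fin 3} (h : i ≠ j) : Commute (zg i) (tv (e j)) :=
  (ee_comm i j).mul_left (ef_comm h.symm).symm
lemma zf_comm {i j : Fin 3} (h : i ≠ j) : Commute (zg i) (tv (f j)) :=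
  (ef_comm h).mul_left (ff_comm i j)
lemma zz_comm {i j : Fin 3} (h : i ≠ j) : Commute (zg i) (zg j) :=
  (zt_comm h).mul_right (zf_comm h)

lemma tri : Tri (zr ρ) (tr ρ) where
  s3 i := by
    have h : B (e i) (f i) = 1 := by rw [B_e_f, if_pos rfl]
    refine ⟨fun v => ?_, fun v => ?_, fun v => ?_⟩
    · rw [rho_mul, rho_mul, mul_assoc, zg, z_cube h, map_one]; rfl
    · rw [rho_mul, tv_sq, map_one]; rfl
    · rw [rho_mul, rho_mul, rho_mul, zg, t_z h]; simp only [mul_assoc]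
  zz i j h v := by rw [rho_mul, rho_mul, (zz_comm h).eq]
  tt i j h v := by rw [rho_mul, rho_mul, (ee_comm i j).eq]
  zt i j h v := by rw [rho_mul, rho_mul, (zt_comm h).eq]

lemma rho_tv (g : G) (a : W) (v : V) : ρ (tv (act g a)) (ρ g v) = ρ g (ρ (tv a) v) := by
  rw [← tv_conj, rho_mul, rho_mul, inv_mul_cancel_right]

section perm
variable {π : Equiv.Perm (Fin 3)} {g : G}
  (hg : ∀ i, act g (e i) = e (π i) ∧ act g (f i) = f (π i))
include hg

lemma rho_t (i : Fin 3) (v : V) : tr ρ (π i) (ρ g v) = ρ g (tr ρ i v) := by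
  rw [tr, ← (hg i).1, rho_tv]

lemma rho_z (i : Fin 3) (v : V) : zr ρ (π i) (ρ g v) = ρ g (zr ρ i v) := by
  rw [zr, zr, zg, zg, ← rho_mul, ← rho_mul, ← (hg i).1, ← (hg i).2, rho_tv, rho_tv]

lemma rho_inj (v w : V) : ρ g v = ρ g w ↔ v = w :=
  ⟨fun h => by rw [← rho_inv ρ g v, h, rho_inv], fun h => by rw [h]⟩

lemma mem_X (p : Bool) (i : Fin 3) (v : V) :
    ρ g v ∈ Tri.X (zr ρ) (tr ρ) p (π i) ↔ v ∈ Tri.X (zr ρ) (tr ρ) p i := by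
  have h0 : ∀ w, ρ g w = 0 ↔ w = 0 := fun w => by
    have := rho_inj ρ hg w 0
    rwa [map_zero] at this
  cases p
  · simp only [Tri.X, Bool.false_eq_true, if_false, mem_Fx, rho_z ρ hg, rho_inj ρ hg]
  · simp only [Tri.X, if_true, mem_Dx, rho_z ρ hg, rho_t ρ hg, rho_inj ρ hg, ← map_add, h0]

end perm

lemma finrank_eq (g : G) (N M : Submodule (ZMod 2) V) (h : ∀ v, ρ g v ∈ M ↔ v ∈ N) :
    finrank (ZMod 2) N = finrank (ZMod 2) M := by
  let E : V ≃ₗ[ZMod 2] V := LinearEquiv.ofLinear (ρ g) (ρ g⁻¹)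
    (LinearMap.ext fun v => rho_inv' ρ g v) (LinearMap.ext fun v => rho_inv ρ g v)
  have : N.map (E : V →ₗ[ZMod 2] V) = M := by
    ext v
    constructor
    · rintro ⟨w, hw, rfl⟩
      exact (h w).2 hw
    · intro hv
      refine ⟨ρ g⁻¹ v, (h _).1 ?_, rho_inv' ρ g v⟩
      rwa [rho_inv']
  rw [← this]
  exact (E.submoduleMap N).finrank_eq

lemma sym1 (p q r : Bool) :
    Tri.d (zr ρ) (tr ρ) p q r = Tri.d (zr ρ) (tr ρ) q p r := by
  obtain ⟨g, hg⟩ := permG (Equiv.swap 0 1)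
  have k0 := mem_X ρ hg p 0
  have k1 := mem_X ρ hg q 1
  have k2 := mem_X ρ hg r 2
  rw [show Equiv.swap (0 : Fin 3) 1 0 = 1 by decide] at k0
  rw [show Equiv.swap (0 : Fin 3) 1 1 = 0 by decide] at k1
  rw [show Equiv.swap (0 : Fin 3) 1 2 = 2 by decide] at k2
  refine finrank_eq ρ g _ _ fun v => ?_
  simp only [Submodule.mem_inf, k0, k1, k2]
  tauto

lemma sym2 (p q r : Bool) :
    Tri.d (zr ρ) (tr ρ) p q r = Tri.d (zr ρ) (tr ρ) p r q := by
  obtain ⟨g, hg⟩ := permG (Equiv.swap 1 2)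
  have k0 := mem_X ρ hg p 0
  have k1 := mem_X ρ hg q 1
  have k2 := mem_X ρ hg r 2
  rw [show Equiv.swap (1 : Fin 3) 2 0 = 0 by decide] at k0
  rw [show Equiv.swap (1 : Fin 3) 2 1 = 2 by decide] at k1
  rw [show Equiv.swap (1 : Fin 3) 2 2 = 1 by decide] at k2
  refine finrank_eq ρ g _ _ fun v => ?_
  simp only [Submodule.mem_inf, k0, k1, k2]
  tauto

/-- The common fixed space of the three order-3 elements. -/
abbrev U : Submodule (ZMod 2) V := Fx (zr ρ 0) ⊓ Fx (zr ρ 1) ⊓ Fx (zr ρ 2)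

lemma mem_U (v : V) : v ∈ U ρ ↔ ∀ i, v ∈ Fx (zr ρ i) := by
  constructor
  · rintro ⟨⟨h0, h1⟩, h2⟩ i
    fin_cases i
    exacts [h0, h1, h2]
  · intro h
    exact ⟨⟨h 0, h 1⟩, h 2⟩

lemma U_triv (i j : Fin 3) (h : ∀ x ∈ U ρ, tr ρ i x = x) : ∀ x ∈ U ρ, tr ρ j x = x := by
  obtain ⟨g, hg⟩ := permG (Equiv.swap i j)
  have hU : ∀ x ∈ U ρ, ρ g⁻¹ x ∈ U ρ := by
    intro x hx
    rw [mem_U] at hx ⊢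
    intro k
    have := mem_X ρ hg false k (ρ g⁻¹ x)
    rw [rho_inv'] at this
    exact this.1 (hx _)
  intro x hx
  have h1 := rho_t ρ hg i (ρ g⁻¹ x)
  rw [rho_inv', Equiv.swap_apply_left, h _ (hU x hx), rho_inv'] at h1
  exact h1

variable (hirr : ∀ N : Submodule (ZMod 2) V, (∀ g, ∀ w ∈ N, ρ g w ∈ N) → N = ⊥ ∨ N = ⊤)
  (hV : finrank (ZMod 2) V = 8)
include hirr hV

lemma nofix (v : V) (hv : ∀ n ∈ gens, ρ (tv (mk n)) v = v) : v = 0 := by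
  let K : Subgroup G :=
    { carrier := {g | ρ g v = v}
      mul_mem' := fun {a b} ha hb => by
        change ρ (a * b) v = v
        rw [← rho_mul, show ρ b v = v from hb, show ρ a v = v from ha]
      one_mem' := by change ρ 1 v = v; rw [map_one]; rfl
      inv_mem' := fun {a} ha => by
        change ρ a⁻¹ v = v
        conv_lhs => rw [← show ρ a v = v from ha]
        exact rho_inv ρ a v }
  have hK : K = ⊤ := gens_top K hv
  have hfix : ∀ g, ρ g v = v := fun g => by
    have : g ∈ K := by rw [hK]; trivial
    exact this
  rcases hirr (Submodule.span (ZMod 2) {v}) (by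
    intro g w hw
    obtain ⟨c, rfl⟩ := Submodule.mem_span_singleton.1 hw
    rw [map_smul, hfix]
    exact hw) with h | h
  · exact Submodule.span_singleton_eq_bot.1 h
  · exfalso
    have h1 := finrank_span_le_card (R := ZMod 2) ({v} : Set V)
    rw [h, finrank_top, hV, Set.toFinset_singleton, Finset.card_singleton] at h1
    omega

lemma caseA (h : Fx (zr ρ 0) = ⊤) : False := by
  have heq : ∀ a b, B a b = 1 → ∀ v, ρ (tv a) v = ρ (tv b) v := by
    intro a b hab v
    obtain ⟨g, rfl, rfl⟩ := pair' a b hab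
    have key : ∀ w, ρ (tv (e 0)) w = ρ (tv (f 0)) w := by
      intro w
      have : ρ (tv (f 0)) w ∈ Fx (zr ρ 0) := by rw [h]; trivial
      have h1 : w ∈ Fx (zr ρ 0) := by rw [h]; trivial
      have h1 := mem_Fx.1 h1
      rw [zr, zg, ← rho_mul] at h1
      rw [← h1, rho_mul, tv_sq, map_one, h1]
      rfl
    rw [← rho_inv' ρ g v, rho_tv, rho_tv, key]
  have all : ∀ n ∈ gens, ∀ v, ρ (tv (mk n)) v = ρ (tv (mk 2)) v := by
    have q : ∀ m n, Bc m n = true → ∀ v, ρ (tv (mk m)) v = ρ (tv (mk n)) v := fun m n hmn =>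
      heq _ _ (by rw [B_mk, hmn]; rfl)
    have a1 := q 16 2 (by decide)
    have a2 := q 3 16 (by decide)
    have a3 := q 8 3 (by decide)
    have a4 := q 6 16 (by decide)
    have a5 := q 32 6 (by decide)
    have a6 := q 4 32 (by decide)
    intro n hn v
    simp only [gens, List.mem_cons, List.not_mem_nil, or_false] at hn
    rcases hn with rfl | rfl | rfl | rfl | rfl | rfl | rfl <;>
      simp only [a6, a5, a4, a3, a2, a1]
  have fx : ∀ v, ρ (tv (mk 2)) v = v → v = 0 := fun v hv =>
    nofix ρ hirr hV v (fun n hn => by rw [all n hn, hv])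
  have : ∀ v : V, v = 0 := by
    intro v
    apply fx
    apply V_eq
    apply fx
    rw [map_add, rho_mul, tv_sq, map_one, add_comm]
    rfl
  have h0 : finrank (ZMod 2) V = 0 := by
    have : Subsingleton V := ⟨fun a b => by rw [this a, this b]⟩
    exact finrank_zero_of_subsingleton
  omega

omit hirr in
lemma rank_le (h : ∀ v, v + tr ρ 0 v ∈ Dx (zr ρ 0) (tr ρ 0))
    (h1 : finrank (ZMod 2) ↥(Dx (zr ρ 0) (tr ρ 0)) ≤ 1) (a : W) (ha : a ≠ 0) :
    finrank (ZMod 2) (LinearMap.range (LinearMap.id + ρ (tv a))) ≤ 1 := by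
  have : FiniteDimensional (ZMod 2) V := FiniteDimensional.of_finrank_pos (by omega)
  obtain ⟨c, hc, -⟩ := exC 0 a ha (fun j hj => absurd hj (Fin.not_lt_zero j))
  obtain ⟨g, rfl, -⟩ := pair' a c hc
  refine le_trans (Submodule.finrank_mono
    (show _ ≤ (Dx (zr ρ 0) (tr ρ 0)).map (ρ g) from ?_)) ((Submodule.finrank_map_le _ _).trans h1)
  rintro _ ⟨v, rfl⟩
  refine ⟨_, h (ρ g⁻¹ v), ?_⟩
  rw [map_add, rho_inv', ← rho_tv, rho_inv']
  rfl

lemma caseB (h : ∀ v, v + tr ρ 0 v ∈ Dx (zr ρ 0) (tr ρ 0))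
    (h1 : finrank (ZMod 2) ↥(Dx (zr ρ 0) (tr ρ 0)) ≤ 1) : False := by
  have : FiniteDimensional (ZMod 2) V := FiniteDimensional.of_finrank_pos (by omega)
  let a : Fin 7 → W := fun i => mk (gens.get i)
  have ha : ∀ i, a i ≠ 0 := by
    have hB : ∀ i, ∃ n : Fin 64, Bc (gens.get i) n = true := by decide
    intro i h0
    obtain ⟨n, hn⟩ := hB i
    have h2 := B_mk (gens.get i) n
    rw [hn, show mk (gens.get i) = 0 from h0] at h2
    simp [B] at h2
  let Φ : V →ₗ[ZMod 2] (∀ i : Fin 7, LinearMap.range (LinearMap.id + ρ (tv (a i)))) :=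
    LinearMap.pi fun i => (LinearMap.id + ρ (tv (a i))).rangeRestrict
  have hΦ : LinearMap.ker Φ ≠ ⊥ := by
    apply LinearMap.ker_ne_bot_of_finrank_lt
    rw [finrank_pi_fintype, hV]
    calc _ ≤ ∑ i : Fin 7, 1 := Finset.sum_le_sum fun i _ => rank_le ρ hV h h1 (a i) (ha i)
      _ < 8 := by simp
  obtain ⟨v, hv, hv0⟩ := Submodule.exists_mem_ne_zero_of_ne_bot hΦ
  apply hv0
  apply nofix ρ hirr hV
  intro n hn
  obtain ⟨i, rfl⟩ := List.get_of_mem hn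
  have := congrArg Subtype.val (congrFun (LinearMap.mem_ker.1 hv) i)
  exact (V_eq this).symm

lemma caseC (h1 : ∀ i, finrank (ZMod 2) ↥(Dx (zr ρ i) (tr ρ i)) ≤ 1)
    (h2 : ∀ i j, i ≠ j → Dx (zr ρ i) (tr ρ i) ⊓ Dx (zr ρ j) (tr ρ j) = ⊥)
    (h3 : finrank (ZMod 2) ↥(U ρ) = 2)
    (h4 : ∀ i, ∃ x ∈ U ρ, tr ρ i x ≠ x) : False := by
  have : FiniteDimensional (ZMod 2) V := FiniteDimensional.of_finrank_pos (by omega)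
  have H := tri ρ
  obtain ⟨u, hu0, hu1, hu2⟩ := H.exists_u h3 h4
  have fixR : ∀ (a : W) (x y : V), y = x + ρ (tv a) x → ρ (tv a) y = y := by
    intro a x y h
    rw [h, map_add, rho_mul, tv_sq, map_one, add_comm]
    rfl
  have hE : ∀ i, ρ (tv (e i)) u = u := fun i => by
    obtain ⟨x, -, hx⟩ := hu1 i
    exact fixR _ x u hx
  have hF : ∀ i, ρ (tv (f i)) u = u := fun i => by
    obtain ⟨x, hx, hx'⟩ := hu1 i
    refine fixR _ x u ?_
    have h1 := mem_Fx.1 ((mem_U ρ x).1 hx i)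
    rw [zr, zg, ← rho_mul] at h1
    rw [hx', tr]
    nth_rewrite 2 [← h1]
    rw [rho_mul, tv_sq, map_one]
    rfl
  -- transport along an element fixing `e 0` and `e 2`
  have tr1 : ∀ g : G, act g (e 0) = e 0 → act g (e 2) = e 2 → ρ g u = u := by
    intro g g0 g2
    obtain ⟨x, -, hx⟩ := hu1 0
    obtain ⟨y, -, hy⟩ := hu1 2
    have k0 : ρ g u = ρ g x + tr ρ 0 (ρ g x) := by
      conv_lhs => rw [hx, map_add, tr, ← rho_tv, g0]
    have k2 : ρ g u = ρ g y + tr ρ 2 (ρ g y) := by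
      conv_lhs => rw [hy, map_add, tr, ← rho_tv, g2]
    rcases H.inter h1 h2 hu2 k0 k2 with h | h
    · exfalso; apply hu0; rw [← rho_inv ρ g u, h, map_zero]
    · exact h
  have key : ∀ a b : W, B a b = 1 → B a (e 0) = 0 → B a (e 2) = 0 → ρ (tv a) u = u := by
    intro a b _ ha0 ha2
    apply tr1
    · rw [act_tv, B_comm, ha0, zero_smul, add_zero]
    · rw [act_tv, B_comm, ha2, zero_smul, add_zero]
  apply hu0
  apply nofix ρ hirr hV
  intro n hn
  simp only [gens, List.mem_cons, List.not_mem_nil, or_false] at hn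
  rcases hn with rfl | rfl | rfl | rfl | rfl | rfl | rfl
  · exact hF 0
  · exact key (mk 3) (mk 8) (by rw [B_mk]; decide) (by rw [e, B_mk]; decide)
      (by rw [e, B_mk]; decide)
  · exact hF 1
  · exact hE 1
  · exact key (mk 6) (mk 16) (by rw [B_mk]; decide) (by rw [e, B_mk]; decide)
      (by rw [e, B_mk]; decide)
  · exact hF 2
  · exact hE 2

/-- The order-3 elements act without fixed points. -/
theorem fpf (i : Fin 3) : Fx (zr ρ i) = ⊥ := by
  have : FiniteDimensional (ZMod 2) V := FiniteDimensional.of_finrank_pos (by omega)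
  have H := tri ρ
  rcases H.cases hV (sym1 ρ) (sym2 ρ) with h | h | ⟨h1, h2, h3⟩
  · exact h i
  · exact (caseA ρ hirr hV h).elim
  · exfalso
    by_cases h4 : ∀ x ∈ U ρ, tr ρ 0 x = x
    · refine caseB ρ hirr hV (fun v => ?_) (h1 0)
      obtain ⟨x, hx, b, hb, h⟩ := H.decomp h1 0 v
      rw [h, h4 x hx, V_self, zero_add]
      exact hb
    · refine caseC ρ hirr hV h1 h2 h3 fun j => ?_
      by_contra! hc
      exact h4 (U_triv ρ j 0 hc)

/-- Every crossed homomorphism is principal. -/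
theorem cocycle (c : G → V) (hc : ∀ g h, c (g * h) = ρ g (c h) + c g) :
    ∃ v, ∀ g, c g = ρ g v - v := by
  have hz0 : ∀ i v, ρ (zg i) v = v → v = 0 := by
    intro i v hv
    have : v ∈ Fx (zr ρ i) := mem_Fx.2 hv
    rwa [fpf ρ hirr hV i, Submodule.mem_bot] at this
  have hsum : ∀ v, v + ρ (zg 0) v + ρ (zg 0) (ρ (zg 0) v) = 0 := by
    intro v
    apply hz0 0
    have := ((tri ρ).s3 0).hz v
    simp only [map_add, this]
    abel
  let v := ρ (zg 0) (c (zg 0))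
  refine ⟨v, ?_⟩
  let b : G → V := fun g => c g + (ρ g v + v)
  have hb : ∀ g h, b (g * h) = ρ g (b h) + b g := by
    intro g h
    simp only [b, hc, map_add, rho_mul]
    linear_combination (norm := module) -V_self (ρ g v)
  have hb0 : b (zg 0) = 0 := by
    have := hsum (c (zg 0))
    simp only [b, v]
    linear_combination (norm := module) this
  have hcomm : ∀ i g, b (zg i) = 0 → Commute (zg i) g → b g = 0 := by
    intro i g hi hg
    apply hz0 i
    have h1 := hb (zg i) g
    rw [hg.eq, hb, hi, map_zero, zero_add, add_zero] at h1
    exact h1.symm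
  have hbz : ∀ i, b (zg i) = 0 := by
    intro i
    by_cases h : i = 0
    · rw [h, hb0]
    · exact hcomm 0 _ hb0 (zz_comm (Ne.symm h))
  have hb1 : b 1 = 0 := by
    have := hb 1 1
    rw [mul_one, map_one] at this
    simpa using this
  let K : Subgroup G :=
    { carrier := {g | b g = 0}
      mul_mem' := fun {x y} hx hy => by
        change b (x * y) = 0
        rw [hb, show b x = 0 from hx, show b y = 0 from hy, map_zero, add_zero]
      one_mem' := hb1
      inv_mem' := fun {x} hx => by
        change b x⁻¹ = 0
        have := hb x⁻¹ x
        rw [inv_mul_cancel, hb1, show b x = 0 from hx, map_zero, zero_add] at this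
        exact this.symm }
  have hK : K = ⊤ := by
    apply gens_top
    have hEK : ∀ i, tv (e i) ∈ K := fun i => by
      obtain ⟨j, hj⟩ := exists_ne i
      exact hcomm j _ (hbz j) (zt_comm hj)
    have hFK : ∀ i, tv (f i) ∈ K := fun i => by
      obtain ⟨j, hj⟩ := exists_ne i
      exact hcomm j _ (hbz j) (zf_comm hj)
    intro n hn
    simp only [gens, List.mem_cons, List.not_mem_nil, or_false] at hn
    rcases hn with rfl | rfl | rfl | rfl | rfl | rfl | rfl
    · exact hFK 0
    · refine hcomm 2 _ (hbz 2) (Commute.mul_left (tv_comm ?_) (tv_comm ?_))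
      · rw [e, B_mk]; decide
      · rw [f, B_mk]; decide
    · exact hFK 1
    · exact hEK 1
    · refine hcomm 0 _ (hbz 0) (Commute.mul_left (tv_comm ?_) (tv_comm ?_))
      · rw [e, B_mk]; decide
      · rw [f, B_mk]; decide
    · exact hFK 2
    · exact hEK 2
  intro g
  have hg : b g = 0 := by
    have : g ∈ K := by rw [hK]; trivial
    exact this
  rw [ZModModule.sub_eq_add]
  exact V_eq hg

end rep
end Sp6

open groupCohomology

/-- **Lemma 2.3.** Let `G = Sp₆(GF(2))` and let `V` be an irreducible representation of `G`
over `GF(2)` of dimension 8. Then `H¹(G, V) = 0`. -/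
theorem stmt_3 (V : Rep (ZMod 2) (Matrix.symplecticGroup (Fin 3) (ZMod 2)))
    (hirr : ∀ W : Submodule (ZMod 2) V,
      (∀ g : Matrix.symplecticGroup (Fin 3) (ZMod 2), ∀ w ∈ W, V.ρ g w ∈ W) →
      W = ⊥ ∨ W = ⊤)
    (hnontriv : Module.finrank (ZMod 2) V = 8) :
    Subsingleton (groupCohomology.H1 V) := by
  suffices h : ∀ x : groupCohomology.H1 V, x = 0 from ⟨fun a b => by rw [h a, h b]⟩
  intro x
  induction x using H1_induction_on with
  | h c =>
    rw [H1π_eq_zero_iff]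
    obtain ⟨v, hv⟩ := Sp6.cocycle V.ρ hirr hnontriv c
      (fun g h => (mem_cocycles₁_iff c).1 c.2 g h)
    exact ⟨v, funext fun g => (hv g).symm⟩
end

section
/- Let p be a prime and E a finite extraspecial p-group, i.e. Z(E) = [E,E] = Φ(E) has order p. Let y be an automorphism of E which fixes Z(E) pointwise, and let F be the preimage in E of the fixed-point subgroup C_{E/Z(E)}(y) of the induced action of y on E/Z(E). Let [E,y] denote the subgroup of E generated by {g⁻¹·y(g) : g ∈ E}. Then C_E(F) = [E,y]·Z(E) and C_E([E,y]) = F. -/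
/-- A finite `p`-group is extraspecial if its center, derived subgroup and Frattini subgroup
coincide and have order `p`. -/
def IsExtraspecial (p : ℕ) (P : Type*) [Group P] : Prop :=
  IsPGroup p P ∧ Subgroup.center P = commutator P ∧ Subgroup.center P = frattini P ∧
    Nat.card (Subgroup.center P) = p

open scoped commutatorElement IsMulCommutative

open Subgroup in
lemma comm_center {E : Type*} [Group E] (h : center E = commutator E) (a b : E) :
    ⁅a, b⁆ ∈ center E := by
  rw [h, _root_.commutator_def]
  exact commutator_mem_commutator (mem_top a) (mem_top b)

open Subgroup in
lemma comm_mul_right {E : Type*} [Group E] (h : center E = commutator E) (a b c : E) :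
    ⁅a, b * c⁆ = ⁅a, b⁆ * ⁅a, c⁆ := by
  have h1 := mem_center_iff.1 (comm_center h a c) b
  have : ⁅a, b * c⁆ = ⁅a, b⁆ * (b * ⁅a, c⁆) * b⁻¹ := by
    simp only [commutatorElement_def]; group
  rw [this, h1]; group

open Subgroup in
lemma comm_mul_left {E : Type*} [Group E] (h : center E = commutator E) (a b c : E) :
    ⁅a * b, c⁆ = ⁅a, c⁆ * ⁅b, c⁆ := by
  have h1 := mem_center_iff.1 (comm_center h b c) a
  have h2 := mem_center_iff.1 (comm_center h b c) ⁅a, c⁆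
  have : ⁅a * b, c⁆ = (a * ⁅b, c⁆) * a⁻¹ * ⁅a, c⁆ := by
    simp only [commutatorElement_def]; group
  rw [this, h1, h2]; group

open Subgroup in
/-- The commutator pairing. -/
noncomputable def pairE {E : Type*} [Group E] (h : center E = commutator E) :
    E →* (Abelianization E →* (center E)ˣ) :=
  MonoidHom.mk' (fun e => Abelianization.lift
    (MonoidHom.mk' (fun g => toUnits (⟨⁅e, g⁆, comm_center h e g⟩ : center E))
      (fun a b => by
        rw [← map_mul]; congr 1; ext; exact comm_mul_right h e a b)))
    (fun a b => by
      ext g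
      simp [comm_mul_left h])

open Subgroup in
lemma pairE_eq_one {E : Type*} [Group E] (h : center E = commutator E) (a b : E) :
    pairE h a (Abelianization.of b) = 1 ↔ ⁅a, b⁆ = 1 := by
  simp [pairE, Subtype.ext_iff, Units.ext_iff]

open Subgroup in
lemma mem_center_of_comm {E : Type*} [Group E] (a : E) (h : ∀ b : E, ⁅a, b⁆ = 1) :
    a ∈ center E :=
  mem_center_iff.2 fun b => (commutatorElement_eq_one_iff_mul_comm.1 (h b)).symm

open Subgroup in
lemma double_centralizer {E : Type*} [Group E] [Finite E] (p : ℕ) (hp : p.Prime)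
    (h : center E = commutator E) (hc : Nat.card (center E) = p) (H : Subgroup E)
    (hH : center E ≤ H) (g : E) (hg : g ∈ centralizer (centralizer (H : Set E) : Set E)) :
    g ∈ H := by
  have : Fact p.Prime := ⟨hp⟩
  have : NeZero p := ⟨hp.ne_zero⟩
  have hofc : ∀ x : E, Abelianization.of x = 1 ↔ x ∈ center E := by
    intro x
    rw [← MonoidHom.mem_ker, Abelianization.ker_of, h]
  have hzp : ∀ z : (center E)ˣ, z ^ p = 1 := by
    intro z
    ext1
    rw [Units.val_pow_eq_pow_val, ← hc, pow_card_eq_one']; rfl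
  have hroots : HasEnoughRootsOfUnity (center E) p := by
    have hcyc : IsCyclic (center E) := isCyclic_of_prime_card hc
    constructor
    · obtain ⟨z, hz⟩ := IsCyclic.exists_ofOrder_eq_natCard (α := center E)
      exact ⟨z, by rw [← hc, ← hz]; exact IsPrimitiveRoot.orderOf z⟩
    · have : IsCyclic (center E)ˣ := isCyclic_of_surjective (toUnits (G := center E)) toUnits.surjective
      infer_instance
  have hexp : ∀ x : Abelianization E, x ^ p = 1 := by
    intro x
    obtain ⟨x, rfl⟩ := QuotientGroup.mk_surjective x
    change (Abelianization.of x) ^ p = 1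
    rw [← map_pow, hofc]
    refine mem_center_of_comm _ fun b => ?_
    rw [← pairE_eq_one h, map_pow, MonoidHom.pow_apply, hzp]
  have h1 : HasEnoughRootsOfUnity (center E) (Monoid.exponent (Abelianization E)) :=
    HasEnoughRootsOfUnity.of_dvd _ (Monoid.exponent_dvd_of_forall_pow_eq_one hexp)
  have hcard := CommGroup.card_monoidHom_of_hasEnoughRootsOfUnity (Abelianization E) (center E)
  have hfin : Finite (Abelianization E →* (center E)ˣ) := DFunLike.finite _
  have hsurj : Function.Surjective (Abelianization.lift (pairE h)) := by
    refine ((Nat.bijective_iff_injective_and_card _).2 ⟨?_, hcard.symm⟩).2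
    rw [injective_iff_map_eq_one]
    intro x hx
    obtain ⟨x, rfl⟩ := QuotientGroup.mk_surjective x
    change Abelianization.lift (pairE h) (Abelianization.of x) = 1 at hx
    change Abelianization.of x = 1
    rw [Abelianization.lift_apply_of] at hx
    rw [hofc]
    refine mem_center_of_comm _ fun b => ?_
    rw [← pairE_eq_one h, hx]; rfl
  by_contra hgH
  let K := H.map (Abelianization.of (G := E))
  have hgK : ((Abelianization.of g : Abelianization E) : Abelianization E ⧸ K) ≠ 1 := by
    rw [Ne, QuotientGroup.eq_one_iff]
    rintro ⟨k, hk, hkg⟩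
    apply hgH
    have : k⁻¹ * g ∈ center E := by
      rw [← hofc, map_mul, map_inv, hkg, inv_mul_cancel]
    simpa using H.mul_mem hk (hH this)
  have h2 : HasEnoughRootsOfUnity (center E) (Monoid.exponent (Abelianization E ⧸ K)) := by
    refine HasEnoughRootsOfUnity.of_dvd _ (Monoid.exponent_dvd_of_forall_pow_eq_one (n := p) ?_)
    intro x
    obtain ⟨x, rfl⟩ := QuotientGroup.mk_surjective x
    rw [← QuotientGroup.mk_pow, hexp]; rfl
  obtain ⟨χ, hχ⟩ := CommGroup.exists_apply_ne_one_of_hasEnoughRootsOfUnity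
    (Abelianization E ⧸ K) (center E) hgK
  obtain ⟨e, he⟩ := hsurj (χ.comp (QuotientGroup.mk' K))
  obtain ⟨e, rfl⟩ := QuotientGroup.mk_surjective e
  change Abelianization.lift (pairE h) (Abelianization.of e) = _ at he
  rw [Abelianization.lift_apply_of] at he
  apply hχ
  have key : ∀ x, pairE h e (Abelianization.of x) = χ (QuotientGroup.mk' K (Abelianization.of x)) :=
    fun x => by rw [he]; rfl
  refine (key g).symm.trans ?_
  rw [pairE_eq_one, commutatorElement_eq_one_iff_mul_comm]
  refine mem_centralizer_iff.1 hg e ?_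
  refine mem_centralizer_iff.2 fun x hx => ?_
  symm
  rw [← commutatorElement_eq_one_iff_mul_comm, ← pairE_eq_one h, key]
  have : QuotientGroup.mk' K (Abelianization.of x) = 1 :=
    (QuotientGroup.eq_one_iff _).2 ⟨x, hx, rfl⟩
  rw [this, map_one]

/-- **Lemma 2.8.** Let `E` be a finite extraspecial `p`-group and `y` an automorphism of `E`
fixing `Z(E)` pointwise.  Let `F` be the preimage in `E` of `C_{E/Z(E)}(y)` and let `[E,y]`
be the subgroup generated by all `g⁻¹ · y(g)`.  Then `C_E(F) = [E,y]·Z(E)` and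
`C_E([E,y]) = F`. -/
theorem stmt_4 {E : Type*} [Group E] [Finite E] (p : ℕ) (hp : p.Prime)
    (hE : IsExtraspecial p E) (y : MulAut E)
    (hy : ∀ z ∈ Subgroup.center E, y z = z)
    (F : Subgroup E) (hF : ∀ g : E, g ∈ F ↔ g⁻¹ * y g ∈ Subgroup.center E) :
    Subgroup.centralizer (F : Set E) =
      Subgroup.closure (Set.range fun g : E => g⁻¹ * y g) ⊔ Subgroup.center E ∧
    Subgroup.centralizer
        ((Subgroup.closure (Set.range fun g : E => g⁻¹ * y g) : Subgroup E) : Set E) = F := by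
  obtain ⟨-, h, -, hc⟩ := hE
  have hy' : ∀ a b : E, ⁅y a, y b⁆ = ⁅a, b⁆ := fun a b => by
    rw [← map_commutatorElement]; exact hy _ (comm_center h a b)
  have hB : Subgroup.centralizer
      ((Subgroup.closure (Set.range fun g : E => g⁻¹ * y g) : Subgroup E) : Set E) = F := by
    rw [Subgroup.centralizer_closure]
    ext b
    have e1 : ∀ a, ⁅b, a⁆ * ⁅b, a⁻¹ * y a⁆ = ⁅b, y a⁆ := fun a => by
      rw [← comm_mul_right h, mul_inv_cancel_left]
    have e2 : ∀ a, ⁅b, y a⁆ * ⁅b⁻¹ * y b, y a⁆ = ⁅b, a⁆ := fun a => by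
      rw [← comm_mul_left h, mul_inv_cancel_left, hy']
    rw [hF, Subgroup.mem_centralizer_iff, Set.forall_mem_range]
    constructor
    · intro hb
      refine mem_center_of_comm _ fun c => ?_
      obtain ⟨a, rfl⟩ := y.surjective c
      have h1 := e1 a
      rw [commutatorElement_eq_one_iff_mul_comm.2 (hb a).symm, mul_one] at h1
      have h2 := e2 a
      rwa [h1, mul_eq_left] at h2
    · intro hb a
      have h2 := e2 a
      rw [commutatorElement_eq_one_iff_mul_comm.2 (Subgroup.mem_center_iff.1 hb (y a)).symm,
        mul_one] at h2
      have h1 := e1 a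
      rw [h2, mul_eq_left] at h1
      exact (commutatorElement_eq_one_iff_mul_comm.1 h1).symm
  refine ⟨?_, hB⟩
  apply le_antisymm
  · intro g hg
    refine double_centralizer p hp h hc _ le_sup_right g ?_
    refine Subgroup.centralizer_le ?_ hg
    rw [← hB]
    exact Subgroup.centralizer_le (SetLike.coe_subset_coe.2 le_sup_left)
  · refine sup_le ?_ (Subgroup.center_le_centralizer _)
    rw [Subgroup.le_centralizer_iff, hB]
end

section
/- Let H be a finite group with normal subgroup Q which is similar to a 3-centralizer in a group of type M(23) or F₂. Then the 3-rank of H/Q is 3: every elementary abelian 3-subgroup of H/Q has order at most 3³ = 27, and H/Q contains an elementary abelian subgroup of order 27. -/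
/-- `O_p(X)`: the largest normal `p`-subgroup of the group `X` (for finite `X` this is the
`p`-core), defined as the join of all normal `p`-subgroups. -/
def Op (p : ℕ) (X : Type*) [Group X] : Subgroup X :=
  sSup {P : Subgroup X | P.Normal ∧ IsPGroup p P}

theorem map_conjAut_eq_of_normal {X : Type*} [Group X] (g : X) {P : Subgroup X}
    (hP : P.Normal) : Subgroup.map (MulAut.conj g).toMonoidHom P = P := by
  ext x
  simp only [Subgroup.mem_map, MulEquiv.coe_toMonoidHom, MulAut.conj_apply]
  constructor
  · rintro ⟨y, hy, rfl⟩
    exact hP.conj_mem y hy g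
  · intro hx
    refine ⟨g⁻¹ * x * g, by simpa using hP.conj_mem x hx g⁻¹, by group⟩

instance Op.normal (p : ℕ) (X : Type*) [Group X] : (Op p X).Normal := by
  constructor
  intro n hn g
  have key : Subgroup.map (MulAut.conj g).toMonoidHom (Op p X) = Op p X := by
    unfold Op
    rw [(Subgroup.gc_map_comap _).l_sSup]
    apply le_antisymm
    · refine iSup_le fun P => iSup_le fun hP => ?_
      rw [map_conjAut_eq_of_normal g hP.1]
      exact le_sSup hP
    · refine sSup_le fun P hP => ?_
      refine le_trans (le_of_eq (map_conjAut_eq_of_normal g hP.1).symm) ?_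
      exact le_iSup₂_of_le P hP le_rfl
  rw [← key]
  exact Subgroup.mem_map.mpr ⟨n, hn, by simp⟩

/-- The symplectic group `Sp₄(GF(3))`. -/
abbrev Sp43 := Matrix.symplecticGroup (Fin 2) (ZMod 3)

/-- `PSp₄(3) ≅ Ω₆⁻(2)`, the quotient of `Sp₄(GF(3))` by its center. -/
abbrev PSp43 := Sp43 ⧸ Subgroup.center Sp43

/-- A finite group `H` with a normal subgroup `Q` is similar to a 3-centralizer in a group of
type `M(23)` or `F₂` (Definitions 1.1 and 1.2 of the paper): `Q = F*(H) = O₃(H) ≅ 3^{1+8}_+`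
with `Z(Q) = Z(H)`, `O₂(H/Q) ≅ 2^{1+6}_-` with `F*(H/Q) = O₂(H/Q)`, and `(H/Q)/O₂(H/Q)` is
isomorphic to `PSp₄(3)` (type `F₂`) or to the centralizer of a 3-central element of `PSp₄(3)`
(type `M(23)`). -/
structure SimilarToM23orF2Centralizer (H : Type*) [Group H] [Finite H]
    (Q : Subgroup H) [Q.Normal] : Prop where
  extraspecial : IsExtraspecial 3 Q
  card_eq : Nat.card Q = 3 ^ 9
  exponent3 : ∀ x ∈ Q, x ^ 3 = 1
  centralizer_eq : Subgroup.centralizer (Q : Set H) = Subgroup.center H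
  center_le : Subgroup.center H ≤ Q
  O2_extraspecial : IsExtraspecial 2 (Op 2 (H ⧸ Q))
  O2_card : Nat.card (Op 2 (H ⧸ Q)) = 2 ^ 7
  O2_minusType : ∀ A : Subgroup (H ⧸ Q), A ≤ Op 2 (H ⧸ Q) → (∀ x ∈ A, x ^ 2 = 1) →
    Nat.card A ≤ 2 ^ 3
  O2_selfCentralizing :
    Subgroup.centralizer ((Op 2 (H ⧸ Q)) : Set (H ⧸ Q)) ≤ Op 2 (H ⧸ Q)
  quotient_iso :
    Nonempty (((H ⧸ Q) ⧸ Op 2 (H ⧸ Q)) ≃* PSp43) ∨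
    ∃ (z : PSp43) (S : Sylow 3 PSp43), orderOf z = 3 ∧ z ∈ (S : Subgroup PSp43) ∧
      z ∈ Subgroup.centralizer ((S : Subgroup PSp43) : Set PSp43) ∧
      Nonempty (((H ⧸ Q) ⧸ Op 2 (H ⧸ Q)) ≃* Subgroup.centralizer {z})

/-- A finite group `H` with a normal subgroup `Q` is similar to a 3-centralizer in a group of
type `F₂` (Definition 1.2 of the paper). -/
structure SimilarToF2Centralizer (H : Type*) [Group H] [Finite H]
    (Q : Subgroup H) [Q.Normal] : Prop where
  extraspecial : IsExtraspecial 3 Q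
  card_eq : Nat.card Q = 3 ^ 9
  exponent3 : ∀ x ∈ Q, x ^ 3 = 1
  centralizer_eq : Subgroup.centralizer (Q : Set H) = Subgroup.center H
  center_le : Subgroup.center H ≤ Q
  O2_extraspecial : IsExtraspecial 2 (Op 2 (H ⧸ Q))
  O2_card : Nat.card (Op 2 (H ⧸ Q)) = 2 ^ 7
  O2_minusType : ∀ A : Subgroup (H ⧸ Q), A ≤ Op 2 (H ⧸ Q) → (∀ x ∈ A, x ^ 2 = 1) →
    Nat.card A ≤ 2 ^ 3
  O2_selfCentralizing :
    Subgroup.centralizer ((Op 2 (H ⧸ Q)) : Set (H ⧸ Q)) ≤ Op 2 (H ⧸ Q)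
  quotient_iso : Nonempty (((H ⧸ Q) ⧸ Op 2 (H ⧸ Q)) ≃* PSp43)

set_option linter.unusedSimpArgs false
/-- Commuting nilpotents have a common almost-kernel vector in `W` modulo `L`. -/
lemma exists_common {F V : Type*} [Field F] [AddCommGroup V] [Module F V]
    (L W : Submodule F V) (hne : ∃ w ∈ W, w ∉ L) {ι : Type*} (n : ι → Module.End F V)
    (hc : ∀ i j, Commute (n i) (n j)) (hn : ∀ i, n i ^ 3 = 0)
    (hL : ∀ i, ∀ x ∈ L, n i x ∈ L) (hW : ∀ i, ∀ x ∈ W, n i x ∈ W) (s : Finset ι) :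
    ∃ w ∈ W, w ∉ L ∧ ∀ i ∈ s, n i w ∈ L := by
  classical
  induction s using Finset.induction_on with
  | empty => obtain ⟨w, h1, h2⟩ := hne; exact ⟨w, h1, h2, by simp⟩
  | insert i s _ ih =>
    obtain ⟨w, hw, hwL, hs⟩ := ih
    have hex : ∃ k, (n i ^ k) w ∈ L := ⟨3, by simp [hn]⟩
    have hk := Nat.find_spec hex
    have hmin := fun m hm => Nat.find_min hex (m := m) hm
    rcases hkk : Nat.find hex with _ | k
    · rw [hkk] at hk; exact absurd (by simpa using hk) hwL
    · rw [hkk] at hk hmin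
      have hpW : ∀ k, ∀ x ∈ W, (n i ^ k) x ∈ W := by
        intro k; induction k with
        | zero => intro x hx; simpa using hx
        | succ k ih => intro x hx; rw [pow_succ']; exact hW _ _ (ih x hx)
      have hpL : ∀ k, ∀ x ∈ L, (n i ^ k) x ∈ L := by
        intro k; induction k with
        | zero => intro x hx; simpa using hx
        | succ k ih => intro x hx; rw [pow_succ']; exact hL _ _ (ih x hx)
      refine ⟨(n i ^ k) w, hpW k w hw, hmin k (Nat.lt_succ_self k), ?_⟩
      intro j hj
      rcases Finset.mem_insert.1 hj with rfl | hj
      · rw [pow_succ'] at hk; exact hk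
      · have : n j ((n i ^ k) w) = (n i ^ k) (n j w) := by
          have := (hc j i).pow_right k
          exact LinearMap.congr_fun this.eq w
        rw [this]; exact hpL k _ (hs j hj)

lemma z3neg : ∀ c : ZMod 3, c = -c → c = 0 := by decide
lemma z3two : (2 : ZMod 3) ≠ 0 := by decide
lemma z3three : (3 : ZMod 3) = 0 := by decide

lemma card_le_of_symplectic {V : Type*} [AddCommGroup V] [Module (ZMod 3) V]
    (hdim : Module.finrank (ZMod 3) V = 4)
    (ω : V →ₗ[ZMod 3] V →ₗ[ZMod 3] ZMod 3) (hskew : ∀ x y, ω x y = - ω y x)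
    (hnd : ∀ x, (∀ y, ω x y = 0) → x = 0)
    {A : Type*} [Group A] [Finite A] (hcomm : ∀ a b : A, a * b = b * a)
    (h3 : ∀ a : A, a ^ 3 = 1)
    (ρ : A →* Module.End (ZMod 3) V) (hinj : Function.Injective ρ)
    (hω : ∀ a x y, ω (ρ a x) (ρ a y) = ω x y) : Nat.card A ≤ 27 := by
  classical
  have : Fact (Nat.Prime 3) := ⟨Nat.prime_three⟩
  have : Fintype A := Fintype.ofFinite A
  have hfd : FiniteDimensional (ZMod 3) V := Module.finite_of_finrank_pos (by omega)
  have halt : ∀ x, ω x x = 0 := by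
    intro x; have := hskew x x; exact z3neg _ this
  let n : A → Module.End (ZMod 3) V := fun a => ρ a - 1
  have hcρ : ∀ a b, Commute (ρ a) (ρ b) := fun a b => by
    show ρ a * ρ b = ρ b * ρ a
    rw [← map_mul, ← map_mul, hcomm]
  have hc : ∀ i j, Commute (n i) (n j) := fun i j =>
    ((hcρ i j).sub_left (Commute.one_left _)).sub_right (Commute.one_right _)
  have hn3 : ∀ i, n i ^ 3 = 0 := by
    intro i
    have h1 : ρ i ^ 3 = 1 := by rw [← map_pow, h3, map_one]
    have h2 : (3 : Module.End (ZMod 3) V) = 0 := by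
      ext x
      have : ((3 : ZMod 3)) • x = 0 := by rw [z3three, zero_smul]
      simpa [Module.End.ofNat_apply, ← Nat.cast_smul_eq_nsmul (ZMod 3)] using this
    have : n i ^ 3 = ρ i ^ 3 - 1 + 3 * (ρ i - ρ i ^ 2) := by
      show (ρ i - 1) ^ 3 = _
      noncomm_ring
    rw [this, h1, h2]; simp
  have hnapp : ∀ i x, ρ i x = x + n i x := fun i x => by simp [n]
  obtain ⟨v, -, hv0, hv⟩ := exists_common (⊥ : Submodule (ZMod 3) V) ⊤
    (by
      have : Nontrivial V := Module.nontrivial_of_finrank_pos (R := ZMod 3) (by omega)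
      obtain ⟨x, hx⟩ := exists_ne (0 : V)
      exact ⟨x, trivial, by simpa using hx⟩) n hc hn3
    (by intro i x hx; simp only [Submodule.mem_bot] at hx ⊢; simp [hx])
    (by intros; trivial) Finset.univ
  have hv' : ∀ i, ρ i v = v := fun i => by
    have := hv i (Finset.mem_univ _)
    rw [hnapp, (Submodule.mem_bot _).1 this, add_zero]
  have hv0' : v ≠ 0 := by simpa using hv0
  obtain ⟨w, hwv, hwL, hw⟩ := exists_common (Submodule.span (ZMod 3) {v}) (LinearMap.ker (ω v))
    (by
      by_contra! hcon
      have h1 : LinearMap.ker (ω v) ≤ Submodule.span (ZMod 3) {v} := hcon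
      have h2 := Submodule.finrank_mono h1
      have h3 := finrank_span_le_card (R := ZMod 3) ({v} : Set V)
      have h4 := (ω v).finrank_range_add_finrank_ker
      have h5 := Submodule.finrank_le (LinearMap.range (ω v))
      simp at h3 h5
      omega) n hc hn3
    (by
      intro i x hx
      obtain ⟨c, rfl⟩ := Submodule.mem_span_singleton.1 hx
      have : n i v = 0 := by have := hnapp i v; rw [hv'] at this; simpa using this
      simp [this])
    (by
      intro i x hx
      rw [LinearMap.mem_ker] at hx ⊢
      have := hω i v x
      rw [hv', hnapp] at this
      simpa [hx] using this) Finset.univ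
  rw [LinearMap.mem_ker] at hwv
  -- build a symplectic basis
  have hex : ∀ x, x ≠ 0 → ∃ y, ω x y = 1 := by
    intro x hx
    by_contra! hcon
    refine hx (hnd x fun y => ?_)
    by_contra hy
    exact hcon ((ω x y)⁻¹ • y) (by simp [hy])
  obtain ⟨v', hvv'⟩ := hex v hv0'
  obtain ⟨w1, hw1⟩ : ∃ w1, w1 = w - ω w v' • v := ⟨_, rfl⟩
  have hw1v : ω v w1 = 0 := by simp [hw1, hwv, halt]
  have hw1v' : ω w1 v' = 0 := by simp [hw1, hvv']
  have hw10 : w1 ≠ 0 := by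
    rintro h
    rw [h] at hw1
    exact hwL (Submodule.mem_span_singleton.2 ⟨_, (sub_eq_zero.1 hw1.symm).symm⟩)
  have hw1t : ∀ i, ∃ t : ZMod 3, ρ i w1 = w1 + t • v := by
    intro i
    obtain ⟨t, ht⟩ := Submodule.mem_span_singleton.1 (hw i (Finset.mem_univ _))
    refine ⟨t, ?_⟩
    rw [hw1, map_sub, map_smul, hv', hnapp, ht]; abel
  obtain ⟨y, hy⟩ := hex w1 hw10
  obtain ⟨y1, hy1⟩ : ∃ y1, y1 = y - ω v y • v' := ⟨_, rfl⟩
  have h1 : ω w1 y1 = 1 := by simp [hy1, hy, hw1v']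
  have h2 : ω v y1 = 0 := by simp [hy1, hvv']
  obtain ⟨w', hw'⟩ : ∃ w', w' = y1 + ω v' y1 • v := ⟨_, rfl⟩
  have hwv0 : ω w1 v = 0 := by rw [hskew, hw1v, neg_zero]
  have hv'v : ω v' v = -1 := by rw [hskew, hvv']
  have hww' : ω w1 w' = 1 := by simp [hw', h1, hwv0]
  have hvw' : ω v w' = 0 := by simp [hw', h2, halt]
  have hv'w' : ω v' w' = 0 := by simp [hw', hv'v]
  have hw'w : ω w' w1 = -1 := by rw [hskew, hww']
  have hw'v : ω w' v = 0 := by rw [hskew, hvw', neg_zero]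
  have hw'v' : ω w' v' = 0 := by rw [hskew, hv'w', neg_zero]
  have hv'w : ω v' w1 = 0 := by rw [hskew, hw1v', neg_zero]
  clear_value n
  clear hw' hy1 h1 h2 hy y y1 hw1 hwL hw hwv w
  have hspan : ∀ x, x = ω x v' • v + ω x w' • w1 - ω x v • v' - ω x w1 • w' := by
    have hli : LinearIndependent (ZMod 3) ![v, w1, v', w'] := by
      rw [Fintype.linearIndependent_iff]
      intro g hg
      simp only [Fin.sum_univ_four] at hg
      simp at hg
      have e1 := congrArg (ω v) hg
      have e2 := congrArg (ω w1) hg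
      have e3 := congrArg (ω v') hg
      have e4 := congrArg (ω w') hg
      simp [halt, hvv', hv'v, hw1v, hwv0, hw1v', hv'w, hww', hw'w, hvw', hw'v, hv'w', hw'v'] at e1 e2 e3 e4
      intro i; fin_cases i <;> simp [e1, e2, e3, e4]
    have htop := hli.span_eq_top_of_card_eq_finrank' (by simp [hdim])
    intro x
    have hx : x ∈ Submodule.span (ZMod 3) (Set.range ![v, w1, v', w']) := htop ▸ trivial
    obtain ⟨c, rfl⟩ := (Submodule.mem_span_range_iff_exists_fun _).1 hx
    simp only [Fin.sum_univ_four]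
    simp [halt, hvv', hv'v, hw1v, hwv0, hw1v', hv'w, hww', hw'w, hvw', hw'v, hv'w', hw'v']
  choose t ht using hw1t
  -- coordinates
  have hgv : ∀ i, ρ i v' = ω (ρ i v') v' • v + ω (ρ i v') w' • w1 + v' - t i • w' := by
    intro i
    have a1 : ω (ρ i v') v = -1 := by have := hω i v' v; rw [hv'] at this; rw [this, hv'v]
    have a2 : ω (ρ i v') w1 = t i := by
      have := hω i v' w1
      rw [ht] at this
      simp [a1, hv'w] at this
      linear_combination this
    conv_lhs => rw [hspan (ρ i v'), a1, a2]
    simp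
  have hgw : ∀ i, ρ i w' = ω (ρ i w') v' • v + ω (ρ i w') w' • w1 + w' := by
    intro i
    have a1 : ω (ρ i w') v = 0 := by have := hω i w' v; rw [hv'] at this; rw [this, hw'v]
    have a2 : ω (ρ i w') w1 = -1 := by
      have := hω i w' w1
      rw [ht] at this
      simp [a1, hw'w] at this
      linear_combination this
    conv_lhs => rw [hspan (ρ i w'), a1, a2]
    simp
  obtain ⟨a, ha⟩ : ∃ a : A → ZMod 3, ∀ i, ω (ρ i v') v' = a i := ⟨_, fun _ => rfl⟩
  obtain ⟨b, hb⟩ : ∃ a : A → ZMod 3, ∀ i, ω (ρ i v') w' = a i := ⟨_, fun _ => rfl⟩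
  obtain ⟨c, hcc⟩ : ∃ a : A → ZMod 3, ∀ i, ω (ρ i w') v' = a i := ⟨_, fun _ => rfl⟩
  obtain ⟨d, hd⟩ : ∃ a : A → ZMod 3, ∀ i, ω (ρ i w') w' = a i := ⟨_, fun _ => rfl⟩
  simp only [ha, hb, hcc, hd] at hgv hgw
  have hceq : ∀ i, c i = b i + t i * d i := by
    intro i
    have := hω i v' w'
    rw [hgv, hgw] at this
    simp [halt, hvv', hv'v, hw1v, hwv0, hw1v', hv'w, hww', hw'w, hvw', hw'v, hv'w', hw'v'] at this
    linear_combination -this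
  have hdet : ∀ i j, t i = t j → a i = a j → b i = b j → d i = d j → i = j := by
    intro i j e1 e2 e3 e4
    apply hinj
    ext x
    rw [hspan x]
    simp only [map_add, map_sub, map_smul, hv', ht, hgv, hgw, hceq, e1, e2, e3, e4]
  have k1 : ∀ i j, d j * t i = d i * t j := by
    intro i j
    have := congrArg (fun x => ω x v') (LinearMap.congr_fun (hcρ i j).eq w')
    simp only [Module.End.mul_apply, hgw, map_add, map_sub, map_smul, hv', ht] at this
    simp [halt, hvv', hv'v, hw1v, hwv0, hw1v', hv'w, hww', hw'w, hvw', hw'v, hv'w', hw'v'] at this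
    linear_combination this
  have k2 : ∀ i j, 2 * (b j * t i - b i * t j) = t i * t j * (d i - d j) := by
    intro i j
    have := congrArg (fun x => ω x v') (LinearMap.congr_fun (hcρ i j).eq v')
    simp only [Module.End.mul_apply, hgv, hgw, map_add, map_sub, map_smul, hv', ht] at this
    simp [halt, hvv', hv'v, hw1v, hwv0, hw1v', hv'w, hww', hw'w, hvw', hw'v, hv'w', hw'v'] at this
    rw [hceq, hceq] at this
    linear_combination this
  have hfin : ∀ f : A → ZMod 3 × ZMod 3 × ZMod 3, Function.Injective f → Nat.card A ≤ 27 := by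
    intro f hf
    have := Nat.card_le_card_of_injective f hf
    simpa using this
  by_cases hall : ∀ i, t i = 0
  · refine hfin (fun i => (a i, b i, d i)) fun i j hij => ?_
    simp only [Prod.mk.injEq] at hij
    exact hdet i j (by rw [hall, hall]) hij.1 hij.2.1 hij.2.2
  · push Not at hall
    obtain ⟨g, hg⟩ := hall
    refine hfin (fun i => (a i, t i, 0)) fun i j hij => ?_
    simp only [Prod.mk.injEq] at hij
    obtain ⟨e1, e2, -⟩ := hij
    have hdd : d i = d j := by
      apply mul_right_cancel₀ hg
      rw [k1 g i, k1 g j, e2]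
    refine hdet i j e2 e1 ?_ hdd
    apply mul_right_cancel₀ hg
    have p1 := k2 g i
    have p2 := k2 g j
    rw [e2, hdd] at p1
    have h20 : (2 : ZMod 3) ≠ 0 := z3two
    apply mul_left_cancel₀ h20
    linear_combination p1 - p2

/-- Lifting an elementary abelian 3-subgroup through a map with 2-group kernel. -/
lemma exists_lift {X Y : Type*} [Group X] [Group Y] [Finite X] (f : X →* Y)
    (hk : IsPGroup 2 f.ker) (E : Subgroup Y) (hE : E ≤ f.range)
    (h3 : ∀ x ∈ E, x ^ 3 = 1) (hc : ∀ a ∈ E, ∀ b ∈ E, a * b = b * a) :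
    ∃ E' : Subgroup X, (∀ x ∈ E', x ^ 3 = 1) ∧ (∀ a ∈ E', ∀ b ∈ E', a * b = b * a) ∧
      Nat.card E' = Nat.card E := by
  classical
  let P : Subgroup X := E.comap f
  let φ : P →* Y := f.comp P.subtype
  have hmem : ∀ x : P, φ x ∈ E := fun x => x.2
  let ψ : P →* E := φ.codRestrict E hmem
  have hsurj : Function.Surjective ψ := by
    rintro ⟨y, hy⟩
    obtain ⟨x, rfl⟩ := hE hy
    exact ⟨⟨x, hy⟩, rfl⟩
  have hk2 : IsPGroup 2 ψ.ker := by
    rintro ⟨⟨x, hx⟩, hx'⟩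
    have : x ∈ f.ker := by
      rw [MonoidHom.mem_ker] at hx' ⊢
      exact congrArg Subtype.val hx'
    obtain ⟨k, hk⟩ := hk ⟨x, this⟩
    refine ⟨k, ?_⟩
    have hk' := congrArg Subtype.val hk
    ext
    simpa using hk'
  have hEfin : Finite E := Finite.of_surjective ψ hsurj
  have hE3 : IsPGroup 3 E := fun x => ⟨1, by ext; simpa using h3 x x.2⟩
  have : Fact (Nat.Prime 2) := ⟨Nat.prime_two⟩
  have : Fact (Nat.Prime 3) := ⟨Nat.prime_three⟩
  have hidx : ψ.ker.index = Nat.card E := by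
    rw [Subgroup.index_ker, MonoidHom.range_eq_top.2 hsurj, Subgroup.card_top]
  have hcop : Nat.Coprime (Nat.card ψ.ker) ψ.ker.index := by
    rw [hidx]
    obtain ⟨m, hm⟩ := IsPGroup.iff_card.1 hk2
    obtain ⟨k, hk⟩ := IsPGroup.iff_card.1 hE3
    rw [hm, hk]
    exact Nat.Coprime.pow _ _ (by norm_num)
  obtain ⟨K, hK⟩ := Subgroup.exists_right_complement'_of_coprime hcop
  have hinj : ∀ a ∈ K, ∀ b ∈ K, ψ a = ψ b → a = b := by
    intro a ha b hb hab
    have h1 : a⁻¹ * b ∈ ψ.ker := by rw [MonoidHom.mem_ker]; simp [hab]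
    have h2 : a⁻¹ * b ∈ K := K.mul_mem (K.inv_mem ha) hb
    have := Subgroup.disjoint_def.1 hK.disjoint h1 h2
    exact (inv_mul_eq_one.1 this)
  refine ⟨K.map P.subtype, ?_, ?_, ?_⟩
  · rintro _ ⟨x, hx, rfl⟩
    have : x ^ 3 = 1 := hinj _ (K.pow_mem hx 3) _ K.one_mem (by
      ext; simpa using h3 _ (ψ x).2)
    simpa using congrArg Subtype.val this
  · rintro _ ⟨x, hx, rfl⟩ _ ⟨y, hy, rfl⟩
    have : x * y = y * x := hinj _ (K.mul_mem hx hy) _ (K.mul_mem hy hx) (by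
      ext; simpa using hc _ (ψ x).2 _ (ψ y).2)
    simpa using congrArg Subtype.val this
  · rw [Subgroup.card_map_of_injective P.subtype_injective, ← hidx]
    exact hK.symm.index_eq_card.symm

open Matrix in
lemma sp43_card_le (A : Subgroup Sp43) (h3 : ∀ x ∈ A, x ^ 3 = 1)
    (hc : ∀ a ∈ A, ∀ b ∈ A, a * b = b * a) : Nat.card A ≤ 27 := by
  have : Fact (Nat.Prime 3) := ⟨Nat.prime_three⟩
  let ω : ((Fin 2 ⊕ Fin 2) → ZMod 3) →ₗ[ZMod 3] ((Fin 2 ⊕ Fin 2) → ZMod 3) →ₗ[ZMod 3] ZMod 3 :=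
    Matrix.toLinearMap₂' (ZMod 3) (J (Fin 2) (ZMod 3))
  have hωapp : ∀ x y, ω x y = x ⬝ᵥ (J (Fin 2) (ZMod 3) *ᵥ y) := fun x y =>
    Matrix.toLinearMap₂'_apply' _ x y
  let ρ : A →* Module.End (ZMod 3) ((Fin 2 ⊕ Fin 2) → ZMod 3) :=
    (MonoidHomClass.toMonoidHom (Matrix.toLinAlgEquiv' (R := ZMod 3) (n := Fin 2 ⊕ Fin 2))).comp
      ((Submonoid.subtype _).comp A.subtype)
  have hρ : ∀ a x, ρ a x = (a : Sp43).1 *ᵥ x := fun a x => rfl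
  refine card_le_of_symplectic (by simp) ω ?_ ?_ (A := A) ?_ ?_ ρ ?_ ?_
  · intro x y
    rw [hωapp, hωapp, Matrix.dotProduct_mulVec, ← Matrix.mulVec_transpose, J_transpose,
      dotProduct_comm, Matrix.neg_mulVec, dotProduct_neg]
  · intro x hx
    ext i
    have := hx (J (Fin 2) (ZMod 3) *ᵥ Pi.single i 1)
    rw [hωapp, Matrix.mulVec_mulVec, J_squared] at this
    rw [Matrix.neg_mulVec, Matrix.one_mulVec] at this
    simpa using this
  · exact fun a b => Subtype.ext (hc a a.2 b b.2)
  · exact fun a => Subtype.ext (by simpa using h3 a a.2)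
  · intro a b hab
    have := Matrix.toLinAlgEquiv'.injective hab
    exact Subtype.ext (Subtype.ext this)
  · intro a x y
    have := SymplecticGroup.mem_iff'.1 (a : Sp43).2
    rw [hρ, hρ, hωapp, hωapp, Matrix.dotProduct_mulVec, ← Matrix.vecMul_transpose,
      Matrix.vecMul_vecMul, ← Matrix.dotProduct_mulVec, Matrix.mulVec_mulVec, this]

lemma mem_sp_upper (S : Matrix (Fin 2) (Fin 2) (ZMod 3)) (hS : S.transpose = S) :
    Matrix.fromBlocks 1 S 0 1 ∈ Matrix.symplecticGroup (Fin 2) (ZMod 3) := by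
  rw [SymplecticGroup.fromBlocks_mem_iff]; simp [hS]

/-- The matrix `1 S; 0 1`. -/
def upp (S : Matrix (Fin 2) (Fin 2) (ZMod 3)) (hS : S.transpose = S) : Sp43 :=
  ⟨_, mem_sp_upper S hS⟩

open Matrix in
lemma center_sq (z : Sp43) (hz : z ∈ Subgroup.center Sp43) : z ^ 2 = 1 := by
  rw [Subgroup.mem_center_iff] at hz
  have hJ := congrArg Subtype.val (hz (SymplecticGroup.symJ _ _))
  have hU := fun S hS => congrArg Subtype.val (hz (upp S hS))
  obtain ⟨z, hzm⟩ := z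
  obtain ⟨a, b, c, d, rfl⟩ : ∃ a b c d, z = fromBlocks a b c d :=
    ⟨_, _, _, _, (fromBlocks_toBlocks z).symm⟩
  simp only [upp, SymplecticGroup.coe_J, J, Submonoid.coe_mul, fromBlocks_multiply,
    fromBlocks_inj] at hJ hU
  simp at hJ hU
  have h1 := (hU 1 (by simp)).1
  simp at h1
  have hs := (hU !![1, 0; 0, 0] (by ext i j; fin_cases i <;> fin_cases j <;> rfl)).2.1
  rw [SymplecticGroup.fromBlocks_mem_iff] at hzm
  obtain ⟨hcb, rfl, -, -⟩ := hJ
  subst h1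
  have hb : b = 0 := by simpa using hcb.symm
  subst hb
  have h01 : d 0 1 = 0 := by
    have := congrFun (congrFun hs 0) 1
    simpa [Matrix.mul_apply, Matrix.vecMul, dotProduct] using this
  have h10 : d 1 0 = 0 := by
    have := congrFun (congrFun hs 1) 0
    simpa [Matrix.mul_apply, Matrix.vecMul, dotProduct, eq_comm] using this
  have ht : dᵀ = d := by
    ext i j; fin_cases i <;> fin_cases j <;> simp [h01, h10]
  have hdd : d * d = 1 := by simpa [ht] using hzm.2.2
  apply Subtype.ext
  simp [pow_two, fromBlocks_multiply, hdd]

lemma psp43_card_le (A : Subgroup PSp43) (h3 : ∀ x ∈ A, x ^ 3 = 1)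
    (hc : ∀ a ∈ A, ∀ b ∈ A, a * b = b * a) : Nat.card A ≤ 27 := by
  obtain ⟨E, e1, e2, e3⟩ := exists_lift (QuotientGroup.mk' (Subgroup.center Sp43))
    (by
      rw [QuotientGroup.ker_mk']
      exact fun x => ⟨1, by ext1; simpa using center_sq x x.2⟩) A
    (by rw [MonoidHom.range_eq_top.2 (QuotientGroup.mk'_surjective _)]; exact le_top) h3 hc
  rw [← e3]
  exact sp43_card_le E e1 e2

/-- Symmetric 2x2 matrix with given entries. -/
def sym (p : ZMod 3 × ZMod 3 × ZMod 3) : Matrix (Fin 2) (Fin 2) (ZMod 3) :=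
  !![p.1, p.2.1; p.2.1, p.2.2]

lemma sym_t (p) : (sym p).transpose = sym p := by
  ext i j; fin_cases i <;> fin_cases j <;> rfl

/-- The unipotent radical, as a homomorphism. -/
def uh : Multiplicative (ZMod 3 × ZMod 3 × ZMod 3) →* Sp43 where
  toFun p := upp (sym p.toAdd) (sym_t _)
  map_one' := by
    apply Subtype.ext
    have : sym (Multiplicative.toAdd 1) = 0 := by
      ext i j; fin_cases i <;> fin_cases j <;> rfl
    simp only [upp, this]; simp
  map_mul' p q := by
    apply Subtype.ext
    have : sym (Multiplicative.toAdd (p * q)) = sym q.toAdd + sym p.toAdd := by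
      ext i j; fin_cases i <;> fin_cases j <;> simp [sym, add_comm]
    simp only [upp, this]; simp [Matrix.fromBlocks_multiply]

open Matrix in
lemma upp_center (S hS) (h : upp S hS ∈ Subgroup.center Sp43) : S = 0 := by
  rw [Subgroup.mem_center_iff] at h
  have hJ := congrArg Subtype.val (h (SymplecticGroup.symJ _ _))
  simp only [upp, SymplecticGroup.coe_J, J, Submonoid.coe_mul, fromBlocks_multiply,
    fromBlocks_inj] at hJ
  simpa using hJ.1.symm

lemma exists_psp43 : ∃ E : Subgroup PSp43, (∀ x ∈ E, x ^ 3 = 1) ∧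
    (∀ a ∈ E, ∀ b ∈ E, a * b = b * a) ∧ Nat.card E = 27 := by
  let f := (QuotientGroup.mk' (Subgroup.center Sp43)).comp uh
  refine ⟨f.range, ?_, ?_, ?_⟩
  · rintro _ ⟨x, rfl⟩
    rw [← map_pow]
    have : x ^ 3 = 1 := by
      revert x; decide
    rw [this, map_one]
  · rintro _ ⟨x, rfl⟩ _ ⟨y, rfl⟩
    rw [← map_mul, ← map_mul, mul_comm]
  · have hinj : Function.Injective f := by
      rw [injective_iff_map_eq_one]
      intro p hp
      have hp' : uh p ∈ Subgroup.center Sp43 := (QuotientGroup.eq_one_iff _).1 hp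
      have := upp_center _ (sym_t _) hp'
      have e1 := congrFun (congrFun this 0) 0
      have e2 := congrFun (congrFun this 0) 1
      have e3 := congrFun (congrFun this 1) 1
      simp [sym] at e1 e2 e3
      exact Multiplicative.toAdd.injective (Prod.ext e1 (Prod.ext e2 e3))
    rw [Nat.card_congr (MonoidHom.ofInjective hinj).symm.toEquiv]
    simp

lemma exists_sylow (S : Sylow 3 PSp43) : ∃ E : Subgroup PSp43, E ≤ S ∧ (∀ x ∈ E, x ^ 3 = 1) ∧
    (∀ a ∈ E, ∀ b ∈ E, a * b = b * a) ∧ Nat.card E = 27 := by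
  have : Fact (Nat.Prime 3) := ⟨Nat.prime_three⟩
  obtain ⟨E, h1, h2, h3⟩ := exists_psp43
  have hE3 : IsPGroup 3 E := fun x => ⟨1, by ext1; simpa using h1 x x.2⟩
  obtain ⟨T, hT⟩ := hE3.exists_le_sylow
  obtain ⟨g, rfl⟩ := MulAction.exists_smul_eq PSp43 T S
  refine ⟨E.map (MulAut.conj g).toMonoidHom, ?_, ?_, ?_, ?_⟩
  · exact Subgroup.map_mono hT
  · rintro _ ⟨x, hx, rfl⟩
    rw [← map_pow, h1 x hx, map_one]
  · rintro _ ⟨x, hx, rfl⟩ _ ⟨y, hy, rfl⟩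
    rw [← map_mul, ← map_mul, h2 x hx y hy]
  · rw [Subgroup.card_map_of_injective (MulAut.conj g).injective, h3]

lemma main_aux {G : Type*} [Group G] [Finite G] (f : G →* PSp43) (hk : IsPGroup 2 f.ker)
    (S : Sylow 3 PSp43) (hS : (S : Subgroup PSp43) ≤ f.range) :
    (∀ A : Subgroup G, (∀ x ∈ A, x ^ 3 = 1) → (∀ a ∈ A, ∀ b ∈ A, a * b = b * a) →
      Nat.card A ≤ 27) ∧
    ∃ A : Subgroup G, (∀ x ∈ A, x ^ 3 = 1) ∧ (∀ a ∈ A, ∀ b ∈ A, a * b = b * a) ∧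
      Nat.card A = 27 := by
  constructor
  · intro A h3 hc
    have hinj : Function.Injective (f.comp A.subtype) := by
      rw [injective_iff_map_eq_one]
      intro x hx
      obtain ⟨k, hk⟩ := hk ⟨x, hx⟩
      have hk' : (x : G) ^ 2 ^ k = 1 := congrArg Subtype.val hk
      have o1 := orderOf_dvd_of_pow_eq_one hk'
      have o2 := orderOf_dvd_of_pow_eq_one (h3 x x.2)
      have : orderOf (x : G) ∣ 1 := by
        have hcop : Nat.Coprime (2 ^ k) 3 := Nat.Coprime.pow_left k (by norm_num)
        rw [← hcop]
        exact Nat.dvd_gcd o1 o2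
      exact Subtype.ext (orderOf_eq_one_iff.1 (Nat.dvd_one.1 this))
    rw [Nat.card_congr (MonoidHom.ofInjective hinj).toEquiv]
    apply psp43_card_le
    · rintro _ ⟨x, rfl⟩
      rw [← map_pow, show x ^ 3 = 1 from Subtype.ext (h3 x x.2), map_one]
    · rintro _ ⟨x, rfl⟩ _ ⟨y, rfl⟩
      rw [← map_mul, ← map_mul, show x * y = y * x from Subtype.ext (hc x x.2 y y.2)]
  · obtain ⟨E, h0, h1, h2, h3⟩ := exists_sylow S
    obtain ⟨E', p1, p2, p3⟩ := exists_lift f hk E (h0.trans hS) h1 h2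
    exact ⟨E', p1, p2, p3.trans h3⟩


/-- **Lemma 4.1(ii).** If `H` is similar to a 3-centralizer in a group of type `M(23)` or
`F₂` with `Q = O₃(H)`, then the 3-rank of `H/Q` is 3: every elementary abelian 3-subgroup
of `H/Q` has order at most 27, and one of order 27 exists. -/
theorem stmt_12 {H : Type*} [Group H] [Finite H] (Q : Subgroup H) [Q.Normal]
    (hH : SimilarToM23orF2Centralizer H Q) :
    (∀ A : Subgroup (H ⧸ Q), (∀ x ∈ A, x ^ 3 = 1) → (∀ a ∈ A, ∀ b ∈ A, a * b = b * a) →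
      Nat.card A ≤ 27) ∧
    ∃ A : Subgroup (H ⧸ Q), (∀ x ∈ A, x ^ 3 = 1) ∧ (∀ a ∈ A, ∀ b ∈ A, a * b = b * a) ∧
      Nat.card A = 27 := by
  have h2 : IsPGroup 2 (Op 2 (H ⧸ Q)) := hH.O2_extraspecial.1
  have hms := QuotientGroup.mk'_surjective (Op 2 (H ⧸ Q))
  have hp2 : ∀ f : (H ⧸ Q) →* PSp43, f.ker = Op 2 (H ⧸ Q) → IsPGroup 2 f.ker := by
    intro f hf; rw [hf]; exact h2
  rcases hH.quotient_iso with ⟨⟨e⟩⟩ | ⟨z, S, -, -, hz, ⟨e⟩⟩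
  · refine main_aux (e.toMonoidHom.comp (QuotientGroup.mk' _)) (hp2 _ ?_) default ?_
    · ext x; simp [MonoidHom.mem_ker]
    · intro y _
      obtain ⟨x, hx⟩ := hms (e.symm y)
      exact ⟨x, by
        rw [MonoidHom.comp_apply, hx]; simp⟩
  · refine main_aux ((Subgroup.subtype _).comp (e.toMonoidHom.comp (QuotientGroup.mk' _)))
      (hp2 _ ?_) S ?_
    · ext x; simp [MonoidHom.mem_ker]
    · intro y hy
      have hy' : y ∈ Subgroup.centralizer {z} := by
        rw [Subgroup.mem_centralizer_singleton_iff]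
        exact (Subgroup.mem_centralizer_iff.1 hz y hy)
      obtain ⟨x, hx⟩ := hms (e.symm ⟨y, hy'⟩)
      exact ⟨x, by
        rw [MonoidHom.comp_apply, MonoidHom.comp_apply, hx]; simp⟩
end

section
/- Let H be a finite group with normal subgroup Q which is similar to a 3-centralizer in a group of type M(23) or F₂, and write Z = Z(Q). Let Ē be an elementary abelian subgroup of H/Q of order 9. Then the fixed-point subgroup C_{Q/Z}(Ē) of Ē acting on Q/Z (via the conjugation action of H/Q on Q/Z, which is well defined since [Q,Q] = Z) has order at most 9. -/
open scoped commutatorElement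

theorem aux_sq {R : Type*} [Group R] (h2 : Nat.card (Subgroup.center R) = 2) {z : R}
    (hz : z ∈ Subgroup.center R) :
    z * z = 1 := by
  have h : (⟨z, hz⟩ : Subgroup.center R) ^ 2 = 1 := by rw [← h2]; exact pow_card_eq_one'
  have := congrArg Subtype.val h
  simpa [pow_two] using this

theorem aux_unique {R : Type*} [Group R] (h2 : Nat.card (Subgroup.center R) = 2) {z y : R}
    (hz : z ∈ Subgroup.center R) (hy : y ∈ Subgroup.center R) (hz1 : z ≠ 1) (hy1 : y ≠ 1) :
    z = y := by
  obtain ⟨a, b, hab, hu⟩ := Nat.card_eq_two_iff.1 h2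
  have h1 : (1 : Subgroup.center R) ∈ ({a, b} : Set _) := hu ▸ Set.mem_univ _
  have h2 : (⟨z, hz⟩ : Subgroup.center R) ∈ ({a, b} : Set _) := hu ▸ Set.mem_univ _
  have h3 : (⟨y, hy⟩ : Subgroup.center R) ∈ ({a, b} : Set _) := hu ▸ Set.mem_univ _
  have h4 : (⟨z, hz⟩ : Subgroup.center R) ≠ 1 := fun h => hz1 (congrArg Subtype.val h)
  have h5 : (⟨y, hy⟩ : Subgroup.center R) ≠ 1 := fun h => hy1 (congrArg Subtype.val h)
  have : (⟨z, hz⟩ : Subgroup.center R) = ⟨y, hy⟩ := by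
    simp only [Set.mem_insert_iff, Set.mem_singleton_iff] at h1 h2 h3
    grind
  exact congrArg Subtype.val this

theorem aux_fix {R : Type*} [Group R] (h2 : Nat.card (Subgroup.center R) = 2) {z : R}
    (hz : z ∈ Subgroup.center R) (a : MulAut R) : a z = z := by
  by_cases h : z = 1
  · simp [h]
  · refine aux_unique h2 ?_ hz (by simpa using h) h
    have := (Subgroup.characteristic_iff_map_eq.1 (inferInstance : (Subgroup.center R).Characteristic)) a
    rw [← this]
    exact Subgroup.mem_map.2 ⟨z, hz, rfl⟩

theorem aux_comm {R : Type*} [Group R] (hc : Subgroup.center R = commutator R) (x y : R) :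
    ⁅x, y⁆ ∈ Subgroup.center R := by
  rw [hc]; exact Subgroup.commutator_mem_commutator (Subgroup.mem_top _) (Subgroup.mem_top _)

theorem aux_comm_mul {R : Type*} [Group R] (hc : Subgroup.center R = commutator R) (x y w : R) :
    ⁅x, y * w⁆ = ⁅x, y⁆ * ⁅x, w⁆ := by
  have h := Subgroup.mem_center_iff.1 (aux_comm hc x w)
  have : ⁅x, y * w⁆ = ⁅x, y⁆ * (y * ⁅x, w⁆ * y⁻¹) := by simp only [commutatorElement_def]; group
  rw [this, h y]; group

theorem aux_mul_comm {R : Type*} [Group R] (hc : Subgroup.center R = commutator R) (x y w : R) :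
    ⁅x * y, w⁆ = ⁅x, w⁆ * ⁅y, w⁆ := by
  have h := Subgroup.mem_center_iff.1 (aux_comm hc y w)
  have : ⁅x * y, w⁆ = (x * ⁅y, w⁆ * x⁻¹) * ⁅x, w⁆ := by simp only [commutatorElement_def]; group
  rw [this, h x, mul_inv_cancel_right, h ⁅x, w⁆]

theorem aux_sq_center {R : Type*} [Group R] (hc : Subgroup.center R = commutator R)
    (h2 : Nat.card (Subgroup.center R) = 2) (x : R) : x * x ∈ Subgroup.center R := by
  rw [Subgroup.mem_center_iff]
  intro g
  have : ⁅g, x * x⁆ = 1 := by rw [aux_comm_mul hc]; exact aux_sq h2 (aux_comm hc _ _)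
  exact (commutatorElement_eq_one_iff_mul_comm.1 this)

theorem aux_lift {R : Type*} [Group R] 
    (h2 : Nat.card (Subgroup.center R) = 2) (a : MulAut R) (ha : a * a * a = 1) (u z : R)
    (hz : z ∈ Subgroup.center R) (h : a u = z * u) : a u = u := by
  have h3 : a (a (a u)) = u := DFunLike.congr_fun ha u
  rw [h, map_mul, aux_fix h2 hz, h, map_mul, map_mul, aux_fix h2 hz, h, ← mul_assoc, aux_sq h2 hz, one_mul] at h3
  rw [h, h3]

theorem aux_norm {R : Type*} [Group R] (hc : Subgroup.center R = commutator R)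
    (h2 : Nat.card (Subgroup.center R) = 2) (a : MulAut R) (ha : a * a * a = 1) (w : R) :
    a (w * a w * a (a w)) = w * a w * a (a w) := by
  have h3 : a (a (a w)) = w := DFunLike.congr_fun ha w
  refine aux_lift h2 a ha _ ⁅w⁻¹, w * a w * a (a w)⁆ (aux_comm hc _ _) ?_
  rw [map_mul, map_mul, h3, commutatorElement_def]
  group

theorem aux_key {R : Type*} [Group R] (hc : Subgroup.center R = commutator R)
    (h2 : Nat.card (Subgroup.center R) = 2) (a b : MulAut R) (ha : a * a * a = 1)
    (hb : b * b * b = 1) (hab : a * b = b * a) (u : R) (hu : a u = u) (hbu : b u ≠ u) :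
    ∃ y, a y = y ∧ (y⁻¹ * b y) ^ 2 ≠ 1 := by
  by_contra! hcon
  have hA : ∀ x, a (b x) = b (a x) := fun x => DFunLike.congr_fun hab x
  have hB : ∀ x, b (b (b x)) = x := fun x => DFunLike.congr_fun hb x
  have hcom : ∀ y, a y = y → ⁅y, b y⁆ = 1 := by
    intro y hy
    rw [commutatorElement_eq_one_iff_mul_comm]
    have h := hcon y hy
    have hz := aux_sq_center hc h2 y
    have hbz : b y * b y = y * y := by rw [← map_mul, aux_fix h2 hz]
    have hz1 := aux_sq h2 hz
    have hi : y⁻¹ = y * y * y := by rw [inv_eq_iff_mul_eq_one]; rw [← hz1]; group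
    have hbi : (b y)⁻¹ = (y * y) * b y := by
      rw [inv_eq_iff_mul_eq_one, ← mul_assoc, Subgroup.mem_center_iff.1 hz, mul_assoc, hbz, hz1]
    have h' : y⁻¹ * b y = (b y)⁻¹ * y := by
      rw [pow_two, mul_eq_one_iff_eq_inv] at h; rw [h]; group
    rw [hi, hbi] at h'
    simp only [mul_assoc, mul_right_inj] at h'
    exact h'
  have hpol : ∀ x y, a x = x → a y = y → ⁅x, b y⁆ * ⁅y, b x⁆ = 1 := by
    intro x y hx hy
    have := hcom (x * y) (by rw [map_mul, hx, hy])
    rw [map_mul, aux_mul_comm hc, aux_comm_mul hc, aux_comm_mul hc, hcom x hx, hcom y hy] at this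
    simpa using this
  -- w commutes with b u * b (b u)
  have hm : ∀ w, a w = w → ⁅w, b u * b (b u)⁆ = 1 := by
    intro w hw
    rw [aux_comm_mul hc]
    have h1 := hpol w u hw hu
    have h2' : b ⁅w, b (b u)⁆ = ⁅w, b (b u)⁆ := aux_fix h2 (aux_comm hc _ _) b
    rw [map_commutatorElement, hB] at h2'
    rw [← h2', ← commutatorElement_inv u (b w)]
    have h3 := aux_sq h2 (aux_comm hc u (b w))
    rw [inv_eq_of_mul_eq_one_right h3]
    rw [mul_eq_one_iff_eq_inv] at h1 ⊢
    rw [h1]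
  have hau : a (b u * b (b u)) = b u * b (b u) := by
    rw [map_mul, hA, hA, hA, hu]
  have hcen : b u * b (b u) ∈ Subgroup.center R := by
    rw [Subgroup.mem_center_iff]
    intro w
    rw [← commutatorElement_eq_one_iff_mul_comm]
    have h1 := hm _ (aux_norm hc h2 a ha w)
    rw [aux_mul_comm hc, aux_mul_comm hc] at h1
    have e1 : ⁅a w, b u * b (b u)⁆ = ⁅w, b u * b (b u)⁆ := by
      conv_lhs => rw [← hau]
      rw [← map_commutatorElement, aux_fix h2 (aux_comm hc _ _)]
    have e2 : ⁅a (a w), b u * b (b u)⁆ = ⁅w, b u * b (b u)⁆ := by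
      conv_lhs => rw [← hau]
      rw [← map_commutatorElement, aux_fix h2 (aux_comm hc _ _), e1]
    rw [e1, e2, aux_sq h2 (aux_comm hc _ _), one_mul] at h1
    exact h1
  apply hbu
  have hbb : b (b u * b (b u)) = b u * b (b u) := aux_fix h2 hcen b
  rw [map_mul, hB] at hbb
  -- b (b u) * u = c central
  have key : (b * b) u = (b u * b (b u) * (u * u)) * u := by
    have : b (b u) = (b u * b (b u)) * u⁻¹ := by rw [← hbb]; group
    have hz1 := aux_sq h2 (aux_sq_center hc h2 u)
    have hi : u⁻¹ = u * u * u := by rw [inv_eq_iff_mul_eq_one]; rw [← hz1]; group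
    rw [hi] at this
    simpa [mul_assoc] using this
  have hb2 : (b * b) * (b * b) * (b * b) = 1 := by
    have : (b * b) * (b * b) * (b * b) = (b * b * b) * (b * b * b) := by group
    rw [this, hb, one_mul]
  have := aux_lift h2 (b * b) hb2 u _ (mul_mem hcen (aux_sq_center hc h2 u)) key
  have h5 : b (b u) = u := this
  have h6 := hB u
  rwa [h5] at h6

theorem aux_prod {W : Type*} [CommGroup W] (hW : ∀ x : W, x * x = 1)
    (w x1 x2 x3 x4 x5 x6 x7 x8 : W) :
    (w * x1 * x2) * (w * x3 * x4) * (w * x5 * x6) * (w * x7 * x8) *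
      ((w * x1 * x2) * (x3 * x5 * x8) * (x4 * x7 * x6)) = w := by
  have : (w * x1 * x2) * (w * x3 * x4) * (w * x5 * x6) * (w * x7 * x8) *
      ((w * x1 * x2) * (x3 * x5 * x8) * (x4 * x7 * x6)) =
      w * (w * w) * (w * w) * (x1 * x1) * (x2 * x2) * (x3 * x3) * (x4 * x4) * (x5 * x5)
        * (x6 * x6) * (x7 * x7) * (x8 * x8) := by ac_rfl
  rw [this]
  simp only [hW, mul_one]

theorem aux_gen {R : Type*} [Group R] (hc : Subgroup.center R = commutator R)
    (h2 : Nat.card (Subgroup.center R) = 2) (a b : MulAut R) (ha : a * a * a = 1)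
    (hb : b * b * b = 1) (hab : a * b = b * a)
    (h1 : ∀ u, a u = u → b u = u) (h3 : ∀ u, (a * b) u = u → b u = u) 
    (h4 : ∀ u, (a * b * b) u = u → b u = u) (w : R) : b w = w := by
  have hA : ∀ x, a (b x) = b (a x) := fun x => DFunLike.congr_fun hab x
  have hB : ∀ x, b (b (b x)) = x := fun x => DFunLike.congr_fun hb x
  have hAA : ∀ x, a (a (a x)) = x := fun x => DFunLike.congr_fun ha x
  have n1 := h1 _ (aux_norm hc h2 a ha w)
  have n2 := aux_norm hc h2 b hb w
  have n3 := h3 _ (aux_norm hc h2 (a * b) (by ext x; simp [hA, hB, hAA]) w)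
  have n4 := h4 _ (aux_norm hc h2 (a * b * b) (by ext x; simp [hA, hB, hAA]) w)
  have n5 := aux_norm hc h2 b hb (w * a w * a (a w))
  simp only [MulAut.mul_apply, hA, hB] at n1 n2 n3 n4 n5
  have hW : ∀ x : Abelianization R, x * x = 1 := by
    intro x
    obtain ⟨r, rfl⟩ := QuotientGroup.mk_surjective x
    have : r * r ∈ commutator R := hc ▸ aux_sq_center hc h2 r
    exact (QuotientGroup.eq_one_iff (r * r)).2 this
  have hp := aux_prod hW (Abelianization.of w) (Abelianization.of (a w))
    (Abelianization.of (a (a w))) (Abelianization.of (b w)) (Abelianization.of (b (b w)))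
    (Abelianization.of (b (a w))) (Abelianization.of (b (b (a (a w)))))
    (Abelianization.of (b (b (a w)))) (Abelianization.of (b (a (a w))))
  simp only [← map_mul] at hp
  have hp' := QuotientGroup.eq.1 hp
  rw [← hc] at hp'
  have hf := aux_fix h2 hp' b
  rw [map_mul, map_inv] at hf
  rw [map_mul b _ (_ * b (w * a w * a (a w)) * _), map_mul b _ (w * b (b (a w)) * b (a (a w))),
    map_mul b _ (w * b (a w) * b (b (a (a w)))), map_mul b _ (w * b w * b (b w)),
    n5, n4, n3, n2, n1] at hf
  exact mul_left_cancel hf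

theorem aux_avg_zero {R : Type*} [Group R] [Fintype R] (hc : Subgroup.center R = commutator R)
    (h2 : Nat.card (Subgroup.center R) = 2)
    {M : Type*} [AddCommGroup M] [Module (ZMod 3) M]
    (ρ : R →* Module.End (ZMod 3) M) (t : R) (ht : t ∈ Subgroup.center R) (ht1 : t ≠ 1)
    (hρ : ρ t = -1) (r : R) (hr : r ∉ Subgroup.center R) :
    ∑ s : R, ρ (s * r * s⁻¹) = 0 := by
  have : ∃ c, c * r * c⁻¹ = t * r := by
    rw [Subgroup.mem_center_iff] at hr
    push Not at hr
    obtain ⟨c, hcr⟩ := hr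
    refine ⟨c, ?_⟩
    have h1 : ⁅c, r⁆ = t := aux_unique h2 (aux_comm hc _ _) ht
      (fun h => hcr (commutatorElement_eq_one_iff_mul_comm.1 h)) ht1
    rw [← h1, commutatorElement_def]; group
  obtain ⟨c, hcr⟩ := this
  have h1 : ∑ s : R, ρ (s * r * s⁻¹) = ∑ s : R, ρ ((s * c) * r * (s * c)⁻¹) :=
    (Fintype.sum_equiv (Equiv.mulRight c) _ _ (fun s => rfl)).symm
  have h2 : ∀ s : R, ρ ((s * c) * r * (s * c)⁻¹) = - ρ (s * r * s⁻¹) := by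
    intro s
    have : (s * c) * r * (s * c)⁻¹ = t * (s * r * s⁻¹) := by
      have : (s * c) * r * (s * c)⁻¹ = s * (c * r * c⁻¹) * s⁻¹ := by group
      rw [this, hcr, ← mul_assoc, Subgroup.mem_center_iff.1 ht]; group
    rw [this, map_mul, hρ, neg_one_mul]
  simp only [h2, Finset.sum_neg_distrib] at h1
  have h3 : (2 : ZMod 3) • ∑ s : R, ρ (s * r * s⁻¹) = 0 := by
    rw [two_smul]; nth_rewrite 1 [h1]; simp
  exact (smul_eq_zero.1 h3).resolve_left (by decide)

theorem aux_dim {R : Type*} [Group R] [Finite R] (hc : Subgroup.center R = commutator R)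
    (h2 : Nat.card (Subgroup.center R) = 2) (hR : Nat.card R = 2 ^ 7)
    {M : Type*} [AddCommGroup M] [Module (ZMod 3) M] [Module.Finite (ZMod 3) M] [Nontrivial M]
    (ρ : R →* Module.End (ZMod 3) M) (t : R) (ht : t ∈ Subgroup.center R) (ht1 : t ≠ 1)
    (hρ : ρ t = -1) : 8 ≤ Module.finrank (ZMod 3) M := by
  classical
  have := Fintype.ofFinite R
  have := Fintype.ofFinite (R ⧸ Subgroup.center R)
  have hli : LinearIndependent (ZMod 3) (fun w : R ⧸ Subgroup.center R => ρ w.out) := by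
    rw [Fintype.linearIndependent_iff]
    intro g hg j
    have h1 : ∀ s : R, ∑ i, g i • ρ (s * (i.out * (j.out)⁻¹) * s⁻¹) = 0 := by
      intro s
      have : ρ s * (∑ i, g i • ρ i.out) * ρ ((j.out)⁻¹ * s⁻¹) = 0 := by rw [hg]; simp
      rw [Finset.mul_sum, Finset.sum_mul] at this
      rw [← this]
      refine Finset.sum_congr rfl fun i _ => ?_
      rw [mul_smul_comm, smul_mul_assoc, ← map_mul, ← map_mul]
      congr 2; group
    have h3 : ∑ s : R, ∑ i, g i • ρ (s * (i.out * (j.out)⁻¹) * s⁻¹) = 0 :=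
      Finset.sum_eq_zero fun s _ => h1 s
    rw [Finset.sum_comm, Finset.sum_eq_single j] at h3
    · simp only [mul_inv_cancel, mul_one, map_one, Finset.sum_const, Finset.card_univ] at h3
      rw [← Nat.card_eq_fintype_card, hR, ← Nat.cast_smul_eq_nsmul (ZMod 3), smul_smul] at h3
      have h4 := (smul_eq_zero.1 h3).resolve_right one_ne_zero
      exact (mul_eq_zero.1 h4).resolve_left (by decide)
    · intro i _ hij
      rw [← Finset.smul_sum, aux_avg_zero hc h2 ρ t ht ht1 hρ, smul_zero]
      intro hmem
      apply hij
      have h5 : (j.out)⁻¹ * i.out ∈ Subgroup.center R := by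
        have := (inferInstance : (Subgroup.center R).Normal).conj_mem _ hmem (j.out)⁻¹
        simpa [mul_assoc] using this
      rw [← QuotientGroup.out_eq' i, ← QuotientGroup.out_eq' j]
      exact (QuotientGroup.eq.2 h5).symm
    · simp
  have h6 := hli.fintype_card_le_finrank
  rw [Module.finrank_linearMap, ← Nat.card_eq_fintype_card] at h6
  have h7 := Subgroup.card_eq_card_quotient_mul_card_subgroup (Subgroup.center R)
  rw [hR, h2] at h7
  nlinarith

theorem aux_neg_one {R : Type*} [Group R] [Finite R] (hc : Subgroup.center R = commutator R)
    (h2 : Nat.card (Subgroup.center R) = 2) (hR : Nat.card R = 2 ^ 7)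
    {M : Type*} [AddCommGroup M] [Module (ZMod 3) M] [Module.Finite (ZMod 3) M]
    (hM : Module.finrank (ZMod 3) M = 8)
    (ρ : R →* Module.End (ZMod 3) M) (t : R) (ht : t ∈ Subgroup.center R)
    (hρ : ρ t ≠ 1) : ρ t = -1 := by
  have ht1 : t ≠ 1 := by rintro rfl; exact hρ (map_one _)
  let N : Submodule (ZMod 3) M := LinearMap.ker (ρ t + 1)
  have hN : ∀ v, v ∈ N ↔ ρ t v = -v := by
    intro v; simp [N, LinearMap.mem_ker, eq_neg_iff_add_eq_zero]
  have hinv : ∀ r : R, ∀ v ∈ N, ρ r v ∈ N := by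
    intro r v hv
    rw [hN] at hv ⊢
    rw [← Module.End.mul_apply, ← map_mul, ← Subgroup.mem_center_iff.1 ht, map_mul,
      Module.End.mul_apply, hv, map_neg]
  let σ : R →* Module.End (ZMod 3) N :=
    { toFun := fun r => (ρ r).restrict (hinv r)
      map_one' := by ext; simp
      map_mul' := by intro a b; ext; simp }
  have hσ : σ t = -1 := by
    ext v
    simpa [σ] using (hN v).1 v.2
  have : Nontrivial N := by
    obtain ⟨v, hv⟩ : ∃ v, ρ t v ≠ v := by
      by_contra! h
      exact hρ (LinearMap.ext h)
    refine ⟨⟨⟨v - ρ t v, ?_⟩, 0, ?_⟩⟩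
    · rw [hN, map_sub, ← Module.End.mul_apply, ← map_mul, aux_sq h2 ht]
      simp
    · intro h
      exact hv (sub_eq_zero.1 (congrArg Subtype.val h)).symm
  have h8 := aux_dim hc h2 hR σ t ht ht1 hσ
  have htop : N = ⊤ := Submodule.eq_top_of_finrank_eq (le_antisymm (Submodule.finrank_le N) (hM ▸ h8))
  ext v
  have : v ∈ N := htop ▸ Submodule.mem_top
  simpa using (hN v).1 this

theorem aux_disjoint {G M : Type*} [Group G] [AddCommGroup M] [Module (ZMod 3) M]
    [Module.Finite (ZMod 3) M] (ρ : G →* Module.End (ZMod 3) M) (y f : G)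
    (h : ρ ((y⁻¹ * (f * y * f⁻¹)) ^ 2) = -1) (A B : Submodule (ZMod 3) M)
    (hA : A ≤ B) (hAB : ∀ v ∈ A, ρ y v ∈ B) (hf : ∀ v ∈ A, ρ f v = v) :
    2 * Module.finrank (ZMod 3) A ≤ Module.finrank (ZMod 3) B := by
  have hinj : Function.Injective (ρ y) := by
    intro v w hvw
    have := congrArg (ρ y⁻¹) hvw
    simpa only [← Module.End.mul_apply, ← map_mul, inv_mul_cancel, map_one,
      Module.End.one_apply] using this
  have hi : ∀ v ∈ A, ρ f⁻¹ v = v := by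
    intro v hv
    conv_lhs => rw [← hf v hv]
    rw [← Module.End.mul_apply, ← map_mul]; simp
  have hd : A ⊓ A.map (ρ y) = ⊥ := by
    rw [eq_bot_iff]
    rintro _ ⟨hv, ⟨v, hvA, rfl⟩⟩
    have h1 : ρ (y⁻¹ * (f * y * f⁻¹)) v = v := by
      simp only [map_mul, Module.End.mul_apply]
      rw [hi v hvA, hf _ hv, ← Module.End.mul_apply, ← map_mul]; simp
    have h3 : ρ ((y⁻¹ * (f * y * f⁻¹)) ^ 2) v = v := by
      rw [pow_two, map_mul, Module.End.mul_apply, h1, h1]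
    rw [h] at h3
    have h4 : (2 : ZMod 3) • v = 0 := by
      rw [two_smul]; nth_rewrite 1 [← h3]; simp
    have := (smul_eq_zero.1 h4).resolve_left (by decide)
    simp [this]
  have h5 := Submodule.finrank_sup_add_finrank_inf_eq A (A.map (ρ y))
  rw [hd, finrank_bot, (Submodule.equivMapOfInjective (ρ y) hinj A).symm.finrank_eq] at h5
  have h6 : A ⊔ A.map (ρ y) ≤ B := by
    refine sup_le hA ?_
    rintro _ ⟨v, hv, rfl⟩
    exact hAB v hv
  have := Submodule.finrank_mono h6
  omega

theorem aux_main {G : Type*} [Group G] [Finite G] (R : Subgroup G) [R.Normal]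
    (hc : Subgroup.center R = commutator R) (h2 : Nat.card (Subgroup.center R) = 2)
    (hR : Nat.card R = 2 ^ 7) (hcent : Subgroup.centralizer (R : Set G) ≤ R)
    (E : Subgroup G) (hEexp : ∀ x ∈ E, x ^ 3 = 1)
    (hEab : ∀ a ∈ E, ∀ b ∈ E, a * b = b * a) (hEcard : Nat.card E = 9)
    {M : Type*} [AddCommGroup M] [Module (ZMod 3) M] [Module.Finite (ZMod 3) M]
    (hM : Module.finrank (ZMod 3) M = 8)
    (ρ : G →* Module.End (ZMod 3) M) (hρ : ∀ t : G, t ≠ 1 → t ^ 2 = 1 → ρ t ≠ 1)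
    (U : Submodule (ZMod 3) M) (hU : ∀ g ∈ E, ∀ v ∈ U, ρ g v = v) :
    Module.finrank (ZMod 3) U ≤ 2 := by
  let φ : G →* MulAut R := MulAut.conjNormal
  have hφ : ∀ g (u : R), ((φ g u : R) : G) = g * u * g⁻¹ := fun g u => by
    simp [φ, MulAut.conjNormal_apply]
  have hmov : ∀ g ∈ E, g ≠ 1 → ∃ u : R, φ g u ≠ u := by
    intro g hg hg1
    by_contra! h
    apply hg1
    have hgR : g ∈ R := by
      apply hcent
      rw [Subgroup.mem_centralizer_iff]
      intro u hu
      have := congrArg Subtype.val (h ⟨u, hu⟩)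
      rw [hφ] at this
      exact (mul_inv_eq_iff_eq_mul.1 this).symm
    have h1 : g ^ (2 ^ 7) = 1 := by
      have : (⟨g, hgR⟩ : R) ^ (2 ^ 7) = 1 := by rw [← hR]; exact pow_card_eq_one'
      simpa using congrArg Subtype.val this
    have h3 := hEexp g hg
    have h4 : g ^ (2 ^ 7) = (g ^ 3) ^ 42 * g ^ 2 := by
      rw [← pow_mul, ← pow_add]; norm_num
    rw [h1, h3, one_pow, one_mul] at h4
    rw [pow_succ, ← h4, one_mul] at h3
    exact h3
  have hcube : ∀ g ∈ E, φ g * φ g * φ g = 1 := by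
    intro g hg
    rw [← map_mul, ← map_mul, ← map_one φ, ← hEexp g hg]
    rw [pow_succ, pow_two]
  -- squares of the good commutators act as -1
  have hneg : ∀ y : R, (y * y : R) ≠ 1 → ρ ((y : G) ^ 2) = -1 := by
    intro y hy
    have hz := aux_sq_center hc h2 y
    have := aux_neg_one hc h2 hR hM (ρ.comp R.subtype) (y * y) hz ?_
    · rw [pow_two]; simpa using this
    · apply hρ
      · intro h; exact hy (Subtype.ext h)
      · rw [← map_pow, pow_two, aux_sq h2 hz, map_one]
  have hgood : ∀ e ∈ E, ∀ f ∈ E, (∃ u : R, φ e u = u ∧ φ f u ≠ u) →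
      ∃ y : R, φ e y = y ∧ ρ (((y : G)⁻¹ * (f * y * f⁻¹)) ^ 2) = -1 := by
    rintro e he f hf ⟨u, hu, hfu⟩
    obtain ⟨y, hy, hy2⟩ := aux_key hc h2 (φ e) (φ f) (hcube e he) (hcube f hf)
      (by rw [← map_mul, ← map_mul, hEab e he f hf]) u hu hfu
    refine ⟨y, hy, ?_⟩
    rw [← hφ]
    exact hneg (y⁻¹ * φ f y) (by rwa [← pow_two])
  have hfinal : ∀ e ∈ E, e ≠ 1 → ∀ f ∈ E, (∃ u : R, φ e u = u ∧ φ f u ≠ u) →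
      Module.finrank (ZMod 3) U ≤ 2 := by
    intro e he he1 f hf hex
    let A : Submodule (ZMod 3) M := LinearMap.ker (ρ e - 1)
    have hA : ∀ v, v ∈ A ↔ ρ e v = v := by
      intro v; simp [A, LinearMap.mem_ker, sub_eq_zero]
    obtain ⟨y, hy, hy2⟩ := hgood e he f hf hex
    obtain ⟨u, hu⟩ := hmov e he he1
    obtain ⟨x, -, hx2⟩ := hgood 1 E.one_mem e he ⟨u, by simp, hu⟩
    have d1 := aux_disjoint ρ x e hx2 A ⊤ le_top (fun _ _ => Submodule.mem_top)
      (fun v hv => (hA v).1 hv)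
    have d2 := aux_disjoint ρ y f hy2 U A (fun v hv => (hA v).2 (hU e he v hv)) ?_
      (fun v hv => hU f hf v hv)
    · rw [finrank_top, hM] at d1
      omega
    · intro v hv
      rw [hA, ← Module.End.mul_apply, ← map_mul]
      have h1 := congrArg Subtype.val hy
      rw [hφ, mul_inv_eq_iff_eq_mul] at h1
      rw [h1, map_mul, Module.End.mul_apply, hU e he v hv]
  -- generators
  obtain ⟨e, he, he1⟩ : ∃ e ∈ E, e ≠ 1 := by
    by_contra! h
    rw [(Subgroup.eq_bot_iff_forall E).2 h, Subgroup.card_bot] at hEcard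
    omega
  obtain ⟨f, hf, hfe⟩ : ∃ f ∈ E, f ∉ Subgroup.zpowers e := by
    by_contra! h
    have h1 := Subgroup.card_le_of_le (show E ≤ Subgroup.zpowers e from h)
    rw [Nat.card_zpowers, hEcard] at h1
    have h3 := orderOf_le_of_pow_eq_one (by norm_num) (hEexp e he)
    omega
  have hf1 : f ≠ 1 := by rintro rfl; exact hfe (one_mem _)
  obtain ⟨w, hw⟩ := hmov f hf hf1
  by_contra hcon
  apply hw
  refine aux_gen hc h2 (φ e) (φ f) (hcube e he) (hcube f hf)
      (by rw [← map_mul, ← map_mul, hEab e he f hf]) ?_ ?_ ?_ w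
  · intro u hu
    by_contra h
    exact hcon (hfinal e he he1 f hf ⟨u, hu, h⟩)
  · intro u hu
    by_contra h
    refine hcon (hfinal (e * f) (mul_mem he hf) ?_ f hf ⟨u, by rwa [map_mul], h⟩)
    intro h1
    rw [eq_comm, ← inv_mul_eq_iff_eq_mul, mul_one] at h1
    exact hfe (h1 ▸ inv_mem (Subgroup.mem_zpowers e))
  · intro u hu
    by_contra h
    refine hcon (hfinal (e * f * f) (mul_mem (mul_mem he hf) hf) ?_ f hf
      ⟨u, by rwa [map_mul, map_mul], h⟩)
    intro h1
    have h3 := hEexp f hf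
    have : e = f := by
      have : e = (e * f * f) * f * (f ^ 3)⁻¹ := by group
      rw [this, h1, h3]; simp
    exact hfe (this ▸ Subgroup.mem_zpowers e)

/-- **Lemma 4.3.** Let `H` be similar to a 3-centralizer in a group of type `M(23)` or `F₂`
with `Q = O₃(H)` and `Z = Z(Q)`.  If `Ē` is an elementary abelian subgroup of `H/Q` of
order 9, then the fixed-point subgroup `C_{Q/Z}(Ē)` of `Ē` acting on `Q/Z` by conjugation
has order at most 9.  (A coset `qZ(Q) ∈ Q/Z` is fixed by `hQ ∈ Ē` precisely when the
commutator `[h,q]` lies in `Z = Z(Q) = Z(H)`.) -/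
theorem stmt_13 {H : Type*} [Group H] [Finite H] (Q : Subgroup H) [Q.Normal]
    (hH : SimilarToM23orF2Centralizer H Q)
    (E : Subgroup (H ⧸ Q)) (hEexp : ∀ x ∈ E, x ^ 3 = 1)
    (hEab : ∀ a ∈ E, ∀ b ∈ E, a * b = b * a) (hEcard : Nat.card E = 9) :
    Nat.card {x : ↥Q ⧸ Subgroup.center ↥Q //
      ∀ q : ↥Q, (QuotientGroup.mk q : ↥Q ⧸ Subgroup.center ↥Q) = x →
        ∀ h : H, ((h : H ⧸ Q) ∈ E) →
          h * (q : H) * h⁻¹ * (q : H)⁻¹ ∈ Subgroup.center H} ≤ 9 := by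
  have hext := hH.extraspecial
  obtain ⟨-, hc, -, h3⟩ := hext
  have hZ : ∀ q : Q, q ∈ Subgroup.center Q ↔ (q : H) ∈ Subgroup.center H := by
    intro q
    rw [← hH.centralizer_eq, Subgroup.mem_centralizer_iff, Subgroup.mem_center_iff]
    constructor
    · intro h g hg
      exact congrArg Subtype.val (h ⟨g, hg⟩)
    · intro h g
      exact Subtype.ext (h g g.2)
  let _ : Module (ZMod 3) (Additive (Abelianization Q)) := AddCommGroup.zmodModule (by
    intro x
    obtain ⟨q, hq⟩ := QuotientGroup.mk_surjective (Additive.toMul x)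
    apply Additive.toMul.injective
    have h1 : q ^ 3 = 1 := Subtype.ext (by simpa using hH.exponent3 q q.2)
    have h5 : (Abelianization.of q) ^ 3 = 1 := by rw [← map_pow, h1, map_one]
    have hq' : Abelianization.of q = Additive.toMul x := hq
    rw [toMul_nsmul, ← hq', h5]; rfl)
  have hcardV : Nat.card (Additive (Abelianization Q)) = 3 ^ 8 := by
    have h7 := Subgroup.card_eq_card_quotient_mul_card_subgroup (commutator Q)
    rw [← hc, h3, hH.card_eq, hc] at h7
    change Nat.card (Q ⧸ commutator Q) = _
    omega
  have : Finite (Additive (Abelianization Q)) := Nat.finite_of_card_ne_zero (by rw [hcardV]; norm_num)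
  have hM : Module.finrank (ZMod 3) (Additive (Abelianization Q)) = 8 := by
    have := Module.natCard_eq_pow_finrank (K := ZMod 3) (V := Additive (Abelianization Q))
    rw [hcardV, Nat.card_zmod] at this
    exact (Nat.pow_right_injective (a := 3) (by norm_num) this).symm
  let ρ0 : H →* Module.End (ZMod 3) (Additive (Abelianization Q)) :=
    { toFun := fun h => (MonoidHom.toAdditive
        (Abelianization.map (MulAut.conjNormal h : MulAut Q).toMonoidHom)).toZModLinearMap 3
      map_one' := by
        apply LinearMap.ext
        intro x
        obtain ⟨q, rfl⟩ := QuotientGroup.mk_surjective x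
        change Abelianization.of ((MulAut.conjNormal (1 : H) : MulAut Q) q) = Abelianization.of q
        simp
      map_mul' := by
        intro a b
        apply LinearMap.ext
        intro x
        obtain ⟨q, rfl⟩ := QuotientGroup.mk_surjective x
        change Abelianization.of ((MulAut.conjNormal (a * b) : MulAut Q) q) =
          Abelianization.of ((MulAut.conjNormal a : MulAut Q) ((MulAut.conjNormal b : MulAut Q) q))
        rw [map_mul]; rfl }
  have hρ0 : ∀ (h : H) (q : Q), ρ0 h (Additive.ofMul (Abelianization.of q)) =
      Additive.ofMul (Abelianization.of ((MulAut.conjNormal h : MulAut Q) q)) := fun _ _ => rfl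
  have hfix : ∀ (h : H) (q : Q), ρ0 h (Additive.ofMul (Abelianization.of q)) =
      Additive.ofMul (Abelianization.of q) ↔
      h * (q : H) * h⁻¹ * (q : H)⁻¹ ∈ Subgroup.center H := by
    intro h q
    have h5 : h * (q : H) * h⁻¹ * (q : H)⁻¹ =
      (((MulAut.conjNormal h : MulAut Q) q * q⁻¹ : Q) : H) := by
      simp [MulAut.conjNormal_apply]
    rw [hρ0, h5, ← hZ, hc, Additive.ofMul.injective.eq_iff, ← mul_inv_eq_one, ← map_inv, ← map_mul]
    exact QuotientGroup.eq_one_iff _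
  have hker : ∀ h ∈ Q, ρ0 h = 1 := by
    intro h hh
    apply LinearMap.ext
    intro x
    obtain ⟨q, rfl⟩ := QuotientGroup.mk_surjective x
    refine (hfix h q).2 ?_
    have : (⁅(⟨h, hh⟩ : Q), q⁆ : Q) ∈ Subgroup.center Q := aux_comm hc _ _
    exact (hZ _).1 this
  let ρ : H ⧸ Q →* Module.End (ZMod 3) (Additive (Abelianization Q)) :=
    QuotientGroup.lift Q ρ0 hker
  have hρ : ∀ h : H, ρ (h : H ⧸ Q) = ρ0 h := fun h => rfl
  have hfaith : ∀ t : H ⧸ Q, t ≠ 1 → t ^ 2 = 1 → ρ t ≠ 1 := by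
    intro t ht ht2 hρt
    obtain ⟨h, rfl⟩ := QuotientGroup.mk_surjective t
    apply ht
    have h2Q : h ^ 2 ∈ Q := (QuotientGroup.eq_one_iff (h ^ 2)).1 (by simpa using ht2)
    have h6 : (h ^ 3) * (h ^ 3) = 1 := by
      have := hH.exponent3 _ h2Q
      rw [← pow_mul] at this
      rwa [← pow_add]
    have hρ3 : ρ0 (h ^ 3) = 1 := by
      rw [map_pow, ← hρ, hρt, one_pow]
    have hc3 : h ^ 3 ∈ Q := by
      apply hH.center_le
      rw [← hH.centralizer_eq, Subgroup.mem_centralizer_iff]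
      intro q hq
      have hz := (hfix (h ^ 3) ⟨q, hq⟩).1 (by rw [hρ3]; rfl)
      simp only at hz
      generalize h ^ 3 = k at *
      have hzQ := hH.center_le hz
      set z := k * q * k⁻¹ * q⁻¹ with hzdef
      have e1 : k * q * k⁻¹ = z * q := by rw [hzdef]; group
      have e2 : z ^ 2 * q = q := by
        have a1 : k * (k * q * k⁻¹) * k⁻¹ = q := by
          have : k * (k * q * k⁻¹) * k⁻¹ = (k * k) * q * (k * k)⁻¹ := by group
          rw [this, h6]; simp
        rw [e1, ← mul_assoc k, Subgroup.mem_center_iff.1 hz k, mul_assoc z, mul_assoc z, e1] at a1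
        rw [pow_two, mul_assoc]; exact a1
      have e3 : z ^ 2 = 1 := by simpa using e2
      have e4 := hH.exponent3 z hzQ
      rw [pow_succ, e3, one_mul] at e4
      rw [e4, one_mul, mul_inv_eq_iff_eq_mul] at e1
      exact e1.symm
    have h8 : ((h : H ⧸ Q)) ^ 3 = 1 := (QuotientGroup.eq_one_iff (h ^ 3)).2 hc3
    rw [pow_succ, ht2, one_mul] at h8
    exact h8
  let U : Submodule (ZMod 3) (Additive (Abelianization Q)) :=
    ⨅ g : E, LinearMap.ker (ρ (g : H ⧸ Q) - 1)
  have hUm : ∀ v, v ∈ U ↔ ∀ g ∈ E, ρ g v = v := by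
    intro v
    simp [U, Submodule.mem_iInf, LinearMap.mem_ker, sub_eq_zero]
  obtain ⟨-, hc2, -, h22⟩ := hH.O2_extraspecial
  have hdim := aux_main (Op 2 (H ⧸ Q)) hc2 h22 hH.O2_card hH.O2_selfCentralizing E hEexp hEab
    hEcard hM ρ hfaith U (fun g hg v hv => (hUm v).1 hv g hg)
  have hcardU : Nat.card U ≤ 9 := by
    rw [Module.natCard_eq_pow_finrank (K := ZMod 3), Nat.card_zmod]
    calc 3 ^ _ ≤ 3 ^ 2 := Nat.pow_le_pow_right (by norm_num) hdim
      _ = 9 := by norm_num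
  refine le_trans ?_ hcardU
  let F : (Q ⧸ Subgroup.center Q) ≃* Abelianization Q := QuotientGroup.quotientMulEquivOfEq hc
  refine Nat.card_le_card_of_injective (fun x => (⟨Additive.ofMul (F x.1), ?_⟩ : U)) ?_
  · rw [hUm]
    intro g hg
    obtain ⟨h, rfl⟩ := QuotientGroup.mk_surjective g
    obtain ⟨x, hx⟩ := x
    obtain ⟨q, rfl⟩ := QuotientGroup.mk_surjective x
    exact (hfix h q).2 (hx q rfl h hg)
  · intro x y hxy
    have h9 := congrArg Subtype.val hxy
    exact Subtype.ext (F.injective (Additive.ofMul.injective h9))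
end
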